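/- arXiv:1811.07477 — 9 statements merged into one kernel-verified Lean document; each statement's English description precedes it below -/
import Mathlib

section
/- If a finite group G has the property that its Chermak-Delgado measure m_G takes exactly two distinct values on the subgroups of G, then the order of the center Z(G) is a prime number. -/
/-- The Chermak–Delgado measure of a subgroup `H` of `G`: `|H| * |C_G(H)|`. -/
noncomputable def cdMeasure {G : Type*} [Group G] (H : Subgroup G) : ℕ :=
  Nat.card H * Nat.card (Subgroup.centralizer (H : Set G))

/-- `G` belongs to the class `C`: its Chermak–Delgado measure takes exactly two
distinct values on the subgroups of `G`. -/
def hasTwoCDValues (G : Type*) [Group G] : Prop :=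
  (Set.range fun H : Subgroup G => cdMeasure H).ncard = 2

theorem Subgroup.card_mul_card_le_card_sup_mul_card_inf {G : Type*} [Group G] [Finite G]
    (H K : Subgroup G) :
    Nat.card H * Nat.card K ≤ Nat.card (H ⊔ K : Subgroup G) * Nat.card (H ⊓ K : Subgroup G) := by
  have h₁ := relIndex_mul_relIndex ⊥ (H ⊓ K) H bot_le inf_le_left
  have h₂ := relIndex_mul_relIndex ⊥ K (H ⊔ K) bot_le le_sup_right
  rw [relIndex_bot_left, relIndex_bot_left] at h₁ h₂
  have h₃ : (H ⊓ K).relIndex H ≤ K.relIndex (H ⊔ K) := by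
    rw [inf_relIndex_left]
    exact relIndex_le_of_le_right le_sup_left fun h => by
      rw [h, mul_zero] at h₂
      exact Nat.card_pos.ne h₂
  rw [← h₁, ← h₂]
  calc _ = (H ⊓ K).relIndex H * (Nat.card (H ⊓ K : Subgroup G) * Nat.card K) := by ring
    _ ≤ K.relIndex (H ⊔ K) * (Nat.card (H ⊓ K : Subgroup G) * Nat.card K) := by gcongr
    _ = _ := by ring

theorem Subgroup.centralizer_sup {G : Type*} [Group G] (H K : Subgroup G) :
    centralizer ((H ⊔ K : Subgroup G) : Set G) =
      centralizer (H : Set G) ⊓ centralizer (K : Set G) := by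
  refine le_antisymm (le_inf (centralizer_le (SetLike.coe_subset_coe.2 le_sup_left))
    (centralizer_le (SetLike.coe_subset_coe.2 le_sup_right))) ?_
  rw [le_centralizer_iff]
  exact sup_le (le_centralizer_iff.1 inf_le_left) (le_centralizer_iff.1 inf_le_right)

theorem cdMeasure_mul_cdMeasure_le {G : Type*} [Group G] [Finite G] (H K : Subgroup G) :
    cdMeasure H * cdMeasure K ≤ cdMeasure (H ⊔ K) * cdMeasure (H ⊓ K) := by
  have h₁ := Subgroup.card_mul_card_le_card_sup_mul_card_inf H K
  have h₂ := Subgroup.card_mul_card_le_card_sup_mul_card_inf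
    (Subgroup.centralizer (H : Set G)) (Subgroup.centralizer (K : Set G))
  rw [← Subgroup.centralizer_sup] at h₂
  have h₃ : Nat.card (Subgroup.centralizer (H : Set G) ⊔ Subgroup.centralizer (K : Set G) :
      Subgroup G) ≤ Nat.card (Subgroup.centralizer ((H ⊓ K : Subgroup G) : Set G)) :=
    Subgroup.card_le_of_le (sup_le
      (Subgroup.centralizer_le (SetLike.coe_subset_coe.2 inf_le_left))
      (Subgroup.centralizer_le (SetLike.coe_subset_coe.2 inf_le_right)))
  replace h₂ := h₂.trans (Nat.mul_le_mul_right _ h₃)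
  unfold cdMeasure
  refine le_trans (le_of_eq ?_) ((Nat.mul_le_mul h₁ h₂).trans (le_of_eq ?_)) <;> ring

theorem cdMeasure_of_le_center {G : Type*} [Group G] {H : Subgroup G}
    (hH : H ≤ Subgroup.center G) : cdMeasure H = Nat.card H * Nat.card G := by
  rw [cdMeasure, Subgroup.centralizer_eq_top_iff_subset.2 hH, Subgroup.card_top]

theorem cdMeasure_top {G : Type*} [Group G] :
    cdMeasure (⊤ : Subgroup G) = Nat.card G * Nat.card (Subgroup.center G) := by
  rw [cdMeasure, Subgroup.coe_top, Subgroup.centralizer_univ, Subgroup.card_top]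

theorem Sylow.prime_dvd_card_centralizer {G : Type*} [Group G] [Finite G] {p : ℕ}
    [hp : Fact p.Prime] (hpG : p ∣ Nat.card G) (P : Sylow p G) :
    p ∣ Nat.card (Subgroup.centralizer ((P : Subgroup G) : Set G)) := by
  have : Nontrivial P :=
    (Subgroup.nontrivial_iff_ne_bot _).2 (P.ne_bot_of_dvd_card hpG)
  have := P.isPGroup'.center_nontrivial
  have h : p ∣ Nat.card (Subgroup.center P) := by
    obtain ⟨n, hn, h⟩ := (P.isPGroup'.to_subgroup (Subgroup.center P)).nontrivial_iff_card.1 this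
    exact h ▸ dvd_pow_self p hn.ne'
  refine h.trans ?_
  rw [← Subgroup.card_map_of_injective (K := Subgroup.center P)
    (P : Subgroup G).subtype_injective]
  refine Subgroup.card_dvd_of_le ?_
  rintro _ ⟨x, hx, rfl⟩
  rw [Subgroup.mem_centralizer_iff]
  intro y hy
  exact congrArg Subtype.val (Subgroup.mem_center_iff.1 hx ⟨y, hy⟩)

theorem Sylow.card_dvd_of_forall_card_dvd {G : Type*} [Group G] [Finite G] {n : ℕ}
    (h : ∀ p, p.Prime → p ∣ Nat.card G → ∀ P : Sylow p G, Nat.card P ∣ n) :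
    Nat.card G ∣ n := by
  rw [Nat.dvd_iff_prime_pow_dvd_dvd]
  intro p k hp hk
  have : Fact p.Prime := ⟨hp⟩
  rcases k.eq_zero_or_pos with rfl | hk₀
  · simp
  · exact ((default : Sylow p G).pow_dvd_card_of_pow_dvd_card hk).trans
      (h p hp ((dvd_pow_self p hk₀.ne').trans hk) _)

theorem Sylow.cdMeasure_ne_card {G : Type*} [Group G] [Finite G] {p : ℕ} [hp : Fact p.Prime]
    (hpG : p ∣ Nat.card G) (P : Sylow p G) :
    cdMeasure (P : Subgroup G) ≠ Nat.card G := by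
  intro h
  refine P.not_dvd_index ?_
  rw [cdMeasure, ← (P : Subgroup G).card_mul_index] at h
  exact Nat.eq_of_mul_eq_mul_left Nat.card_pos h ▸ P.prime_dvd_card_centralizer hpG

theorem cdMeasure_pos {G : Type*} [Group G] [Finite G] (H : Subgroup G) : 0 < cdMeasure H :=
  Nat.mul_pos Nat.card_pos Nat.card_pos

/-- Two values `|G|` and `a` would put every Sylow subgroup, hence their join `G`,
among the subgroups of maximal measure `a`. -/
theorem hasTwoCDValues.card_center_ne_one {G : Type*} [Group G] [Finite G]
    (hG : hasTwoCDValues G) : Nat.card (Subgroup.center G) ≠ 1 := by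
  intro hZ
  have hbot : cdMeasure (⊥ : Subgroup G) = Nat.card G := by
    rw [cdMeasure_of_le_center bot_le, Subgroup.card_bot, one_mul]
  obtain ⟨a, haG, ha⟩ : ∃ a, a ≠ Nat.card G ∧
      Set.range (fun H : Subgroup G => cdMeasure H) = {Nat.card G, a} := by
    obtain ⟨x, y, hxy, h⟩ := Set.ncard_eq_two.1 hG
    have hmem : Nat.card G ∈ ({x, y} : Set ℕ) := h ▸ ⟨⊥, hbot⟩
    rcases hmem with rfl | rfl
    · exact ⟨y, hxy.symm, h⟩
    · exact ⟨x, hxy, h.trans (Set.pair_comm _ _)⟩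
  have hval (H : Subgroup G) : cdMeasure H = Nat.card G ∨ cdMeasure H = a := by
    have : cdMeasure H ∈ ({Nat.card G, a} : Set ℕ) := ha ▸ ⟨H, rfl⟩
    exact this
  have hsyl (p : ℕ) (hp : p.Prime) (hpG : p ∣ Nat.card G) (P : Sylow p G) :
      cdMeasure (P : Subgroup G) = a :=
    have : Fact p.Prime := ⟨hp⟩
    (hval P).resolve_left (P.cdMeasure_ne_card hpG)
  obtain ⟨K, hK⟩ : ∃ K : Subgroup G, cdMeasure K = a := by
    have : a ∈ Set.range (fun H : Subgroup G => cdMeasure H) := by simp [ha]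
    exact this
  have hlt : Nat.card G < a := by
    refine lt_of_le_of_ne (Nat.le_of_dvd (hK ▸ cdMeasure_pos K) ?_) haG.symm
    exact Sylow.card_dvd_of_forall_card_dvd fun p hp hpG P =>
      (Dvd.intro _ rfl).trans (hsyl p hp hpG P).dvd
  have hle (H : Subgroup G) : cdMeasure H ≤ a := by
    rcases hval H with h | h <;> omega
  have hsup (H L : Subgroup G) (hH : cdMeasure H = a) (hL : cdMeasure L = a) :
      cdMeasure (H ⊔ L) = a := by
    refine (hle _).antisymm ?_
    have h := cdMeasure_mul_cdMeasure_le H L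
    rw [hH, hL] at h
    exact Nat.le_of_mul_le_mul_right (h.trans (Nat.mul_le_mul_left _ (hle _))) (by omega)
  obtain ⟨M, hM⟩ := (Set.toFinite {H : Subgroup G | cdMeasure H = a}).exists_maximal ⟨K, hK⟩
  have hMtop : M = ⊤ := by
    refine Subgroup.eq_top_of_le_card _ (Nat.le_of_dvd Nat.card_pos ?_)
    exact Sylow.card_dvd_of_forall_card_dvd fun p hp hpG P =>
      Subgroup.card_dvd_of_le (le_sup_right.trans
        (hM.le_of_ge (hsup M P hM.prop (hsyl p hp hpG P)) le_sup_left))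
  have htop : cdMeasure M = a := hM.prop
  rw [hMtop, cdMeasure_top, hZ, mul_one] at htop
  exact haG htop.symm

theorem center_card_prime_of_hasTwoCDValues (G : Type*) [Group G] [Finite G]
    (hG : hasTwoCDValues G) : (Nat.card (Subgroup.center G)).Prime := by
  have hZ := hG.card_center_ne_one
  obtain ⟨p, hp, hpZ⟩ := Nat.exists_prime_and_dvd hZ
  have : Fact p.Prime := ⟨hp⟩
  obtain ⟨x, hx⟩ := exists_prime_orderOf_dvd_card' p hpZ
  have hK : Subgroup.zpowers (x : G) ≤ Subgroup.center G :=
    Subgroup.zpowers_le.2 x.2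
  have hcard : Nat.card (Subgroup.zpowers (x : G)) = p := by
    rw [Nat.card_zpowers, Subgroup.orderOf_coe, hx]
  have hmem (H : Subgroup G) (hH : H ≤ Subgroup.center G) : Nat.card H * Nat.card G ∈
      Set.range (fun H : Subgroup G => cdMeasure H) := ⟨H, cdMeasure_of_le_center hH⟩
  have h₁ := hmem ⊥ bot_le
  have h₂ := hmem _ hK
  have h₃ := hmem _ le_rfl
  obtain ⟨a, b, -, h⟩ := Set.ncard_eq_two.1 hG
  rw [h, Set.mem_insert_iff, Set.mem_singleton_iff] at h₁ h₂ h₃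
  rw [Subgroup.card_bot] at h₁
  rw [hcard] at h₂
  have hinj {m n : ℕ} (h : m * Nat.card G = n * Nat.card G) : m = n :=
    Nat.eq_of_mul_eq_mul_right Nat.card_pos h
  have h₁₂ : 1 * Nat.card G ≠ p * Nat.card G := fun h => hp.one_lt.ne (hinj h)
  have h₁₃ : 1 * Nat.card G ≠ Nat.card (Subgroup.center G) * Nat.card G :=
    fun h => hZ (hinj h).symm
  have h₂₃ : Nat.card (Subgroup.center G) * Nat.card G = p * Nat.card G := by omega
  exact hinj h₂₃ ▸ hp
end

section
/- If a finite group G has the property that its Chermak-Delgado measure takes exactly two distinct values on its subgroups, then G is a p-group for some prime p, i.e., the order of G is a prime power. -/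
theorem cdMeasure_bot {G : Type*} [Group G] : cdMeasure (⊥ : Subgroup G) = Nat.card G := by
  have h : Subgroup.centralizer ((⊥ : Subgroup G) : Set G) = ⊤ := by
    rw [eq_top_iff]
    intro g _
    simp [Subgroup.mem_centralizer_iff]
  rw [cdMeasure, h, Subgroup.card_bot, Subgroup.card_top, one_mul]

theorem Sylow.dvd_card_centralizer {G : Type*} [Group G] [Finite G] {p : ℕ} [hp : Fact p.Prime]
    (P : Sylow p G) (hdvd : p ∣ Nat.card G) :
    p ∣ Nat.card (Subgroup.centralizer ((P : Subgroup G) : Set G)) := by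
  have : Nontrivial (P : Subgroup G) := by
    rw [Subgroup.nontrivial_iff_ne_bot]
    exact P.ne_bot_of_dvd_card hdvd
  have := P.isPGroup'.center_nontrivial
  obtain ⟨z, hz⟩ := exists_ne (1 : Subgroup.center (P : Subgroup G))
  obtain ⟨k, hk⟩ := IsPGroup.iff_orderOf.mp P.isPGroup' (z : (P : Subgroup G))
  have hmem : ((z : (P : Subgroup G)) : G) ∈ Subgroup.centralizer ((P : Subgroup G) : Set G) := by
    intro g hg
    exact congrArg Subtype.val (Subgroup.mem_center_iff.mp z.2 ⟨g, hg⟩)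
  have hord := Subgroup.orderOf_dvd_natCard _ hmem
  rw [Subgroup.orderOf_coe, hk] at hord
  refine (dvd_pow_self p ?_).trans hord
  rintro rfl
  rw [pow_zero, orderOf_eq_one_iff] at hk
  exact hz (Subtype.ext hk)

/-- The `p`-part of the measure of a Sylow `p`-subgroup exceeds that of `|G|`. -/
theorem Sylow.factorization_card_lt_cdMeasure {G : Type*} [Group G] [Finite G] {p : ℕ}
    [hp : Fact p.Prime] (P : Sylow p G) (hdvd : p ∣ Nat.card G) :
    (Nat.card G).factorization p < (cdMeasure (P : Subgroup G)).factorization p := by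
  rw [cdMeasure, Nat.factorization_mul Nat.card_pos.ne' Nat.card_pos.ne', P.card_eq_multiplicity,
    hp.out.factorization_pow]
  have := hp.out.factorization_pos_of_dvd Nat.card_pos.ne' (P.dvd_card_centralizer hdvd)
  simpa using this

/-- For `q ≠ p`, the `q`-part of the measure of a Sylow `p`-subgroup is at most that of `|G|`. -/
theorem Sylow.factorization_cdMeasure_le {G : Type*} [Group G] [Finite G] {p q : ℕ}
    [hp : Fact p.Prime] (P : Sylow p G) (hpq : p ≠ q) :
    (cdMeasure (P : Subgroup G)).factorization q ≤ (Nat.card G).factorization q := by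
  rw [cdMeasure, Nat.factorization_mul Nat.card_pos.ne' Nat.card_pos.ne', P.card_eq_multiplicity,
    hp.out.factorization_pow]
  have := (Nat.factorization_le_iff_dvd Nat.card_pos.ne' Nat.card_pos.ne').mpr
    (Subgroup.card_subgroup_dvd_card (Subgroup.centralizer ((P : Subgroup G) : Set G))) q
  simpa [Finsupp.single_apply, hpq] using this

theorem isPGroup_of_hasTwoCDValues (G : Type*) [Group G] [Finite G]
    (hG : hasTwoCDValues G) :
    ∃ p : ℕ, p.Prime ∧ IsPGroup p G := by
  by_cases h1 : Nat.card G = 1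
  · exact ⟨2, Nat.prime_two, IsPGroup.of_card (n := 0) (by simpa using h1)⟩
  obtain ⟨p, hp, hpd⟩ := Nat.exists_prime_and_dvd h1
  refine ⟨p, hp, ?_⟩
  by_cases huniq : ∀ {q : ℕ}, q.Prime → q ∣ Nat.card G → q = p
  · exact IsPGroup.of_card (Nat.eq_prime_pow_of_unique_prime_dvd Nat.card_pos.ne' huniq)
  push Not at huniq
  obtain ⟨q, hq, hqd, hqp⟩ := huniq
  have : Fact p.Prime := ⟨hp⟩
  have : Fact q.Prime := ⟨hq⟩
  obtain ⟨P⟩ : Nonempty (Sylow p G) := inferInstance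
  obtain ⟨Q⟩ : Nonempty (Sylow q G) := inferInstance
  have hP := P.factorization_card_lt_cdMeasure hpd
  have hQ := Q.factorization_card_lt_cdMeasure hqd
  have hQ' := Q.factorization_cdMeasure_le hqp
  obtain ⟨x, y, -, hxy⟩ := Set.ncard_eq_two.mp hG
  have hval (H : Subgroup G) : cdMeasure H = x ∨ cdMeasure H = y := by
    have : cdMeasure H ∈ ({x, y} : Set ℕ) := hxy ▸ Set.mem_range_self H
    simpa using this
  have hbot := hval ⊥
  rw [cdMeasure_bot] at hbot
  have hvP := hval P
  have hvQ := hval Q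
  grind
end

section
/- Let p be a prime and let G be a non-abelian p-group of order p^n (n ≥ 3) whose Chermak-Delgado measure takes exactly two distinct values on its subgroups. Then Z(G) is the unique minimal normal subgroup of G: every nontrivial normal subgroup of G contains Z(G). Consequently Z(G) ≤ G' ≤ Φ(G), where G' is the derived subgroup and Φ(G) is the Frattini subgroup of G. -/
namespace Subgroup

variable {G : Type*} [Group G]

/-- The Chermak–Delgado measure of a central subgroup `H` is `|H| * |G|`. -/
theorem cdMeasure_of_le_center {H : Subgroup G} (h : H ≤ center G) :
    cdMeasure H = Nat.card H * Nat.card G := by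
  rw [cdMeasure, centralizer_eq_top_iff_subset.mpr h, card_top]

/-- A nontrivial normal subgroup of a finite `p`-group meets the center nontrivially. -/
theorem exists_ne_one_mem_center_of_isPGroup [Finite G] {p : ℕ} [Fact p.Prime]
    (hG : IsPGroup p G) {N : Subgroup G} [N.Normal] (hN : N ≠ ⊥) :
    ∃ x ∈ N, x ∈ center G ∧ x ≠ 1 := by
  have hdvd : p ∣ Nat.card N :=
    (hG.to_subgroup N).card_eq_or_dvd.resolve_left fun h => hN (eq_bot_of_card_eq N h)
  obtain ⟨b, hb, hne⟩ :=
    (hG.of_equiv ConjAct.toConjAct).exists_fixed_point_of_prime_dvd_card_of_fixed_point N hdvd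
      (a := 1) fun g => smul_one g
  refine ⟨b, b.2, mem_center_iff.mpr fun g => ?_, fun h => hne (Subtype.ext h.symm)⟩
  have h := congrArg Subtype.val (hb (ConjAct.toConjAct g))
  rw [ConjAct.Subgroup.val_conj_smul, ConjAct.toConjAct_smul] at h
  exact mul_inv_eq_iff_eq_mul.mp h

/-- The center of a finite `p`-group whose Chermak–Delgado measure takes exactly two values has
order `p`. -/
theorem card_center_of_hasTwoCDValues [Finite G] [Nontrivial G] {p : ℕ} [hp : Fact p.Prime]
    (hG : IsPGroup p G) (h : hasTwoCDValues G) : Nat.card (center G) = p := by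
  have := hG.center_nontrivial
  have hdvd : p ∣ Nat.card (center G) :=
    (hG.to_subgroup _).card_eq_or_dvd.resolve_left Finite.one_lt_card.ne'
  obtain ⟨x, hx⟩ := exists_prime_orderOf_dvd_card' p hdvd
  have hle : zpowers (x : G) ≤ center G := zpowers_le.mpr x.2
  have hbot := cdMeasure_of_le_center (bot_le : ⊥ ≤ center G)
  have hzp := cdMeasure_of_le_center hle
  have hcen := cdMeasure_of_le_center (le_refl (center G))
  rw [card_bot] at hbot
  rw [Nat.card_zpowers, orderOf_coe, hx] at hzp
  obtain ⟨a, b, -, hab⟩ := Set.ncard_eq_two.mp h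
  have hmem (H : Subgroup G) : cdMeasure H = a ∨ cdMeasure H = b := by
    have hH : cdMeasure H ∈ ({a, b} : Set ℕ) := hab ▸ Set.mem_range_self H
    simpa using hH
  have hinj {k l : ℕ} : k * Nat.card G = l * Nat.card G → k = l :=
    Nat.eq_of_mul_eq_mul_right Nat.card_pos
  have h1p : 1 * Nat.card G ≠ p * Nat.card G := fun e => hp.out.one_lt.ne (hinj e)
  have h1c : 1 * Nat.card G ≠ Nat.card (center G) * Nat.card G :=
    fun e => Finite.one_lt_card.ne (hinj e)
  apply hinj
  rw [← hbot, ← hzp] at h1p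
  rw [← hbot, ← hcen] at h1c
  rw [← hcen, ← hzp]
  have h1 := hmem ⊥
  have h2 := hmem (zpowers (x : G))
  have h3 := hmem (center G)
  omega

/-- The derived subgroup of a nilpotent group is contained in its Frattini subgroup. -/
theorem commutator_le_frattini [Group.IsNilpotent G] : _root_.commutator G ≤ frattini G := by
  refine le_iInf₂ fun M hM => ?_
  have : M.Normal :=
    NormalizerCondition.normal_of_coatom M Group.normalizerCondition_of_isNilpotent hM
  obtain ⟨x, -, hx⟩ := SetLike.exists_of_lt hM.lt_top
  refine Normal.commutator_le_of_self_sup_commutative_eq_top (H := zpowers x)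
    (hM.2 _ (left_lt_sup.mpr fun h => hx (h (mem_zpowers x)))) inferInstance

end Subgroup

theorem center_unique_minimal_normal_of_hasTwoCDValues (G : Type*) [Group G] [Finite G]
    (p n : ℕ) (hp : p.Prime) (hcard : Nat.card G = p ^ n) (hn : 3 ≤ n)
    (hnab : ¬ ∀ a b : G, a * b = b * a)
    (hG : hasTwoCDValues G) :
    (∀ N : Subgroup G, N.Normal → N ≠ ⊥ → Subgroup.center G ≤ N) ∧
      Subgroup.center G ≤ commutator G ∧ commutator G ≤ frattini G := by
  have : Fact p.Prime := ⟨hp⟩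
  have hpG : IsPGroup p G := IsPGroup.of_card hcard
  have : Group.IsNilpotent G := hpG.isNilpotent
  have : Nontrivial G :=
    not_subsingleton_iff_nontrivial.mp fun _ => hnab fun _ _ => Subsingleton.elim _ _
  have hmin (N : Subgroup G) (_ : N.Normal) (hN : N ≠ ⊥) : Subgroup.center G ≤ N := by
    obtain ⟨x, hxN, hxc, hx⟩ := Subgroup.exists_ne_one_mem_center_of_isPGroup hpG hN
    have hc := Subgroup.card_center_of_hasTwoCDValues hpG hG
    intro z hz
    obtain ⟨k, hk⟩ := mem_zpowers_of_prime_card hc (g := ⟨x, hxc⟩) (g' := ⟨z, hz⟩)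
      fun h => hx (congrArg Subtype.val h)
    have hkz : x ^ k = z := congrArg Subtype.val hk
    exact hkz ▸ N.zpow_mem hxN k
  refine ⟨hmin, hmin _ inferInstance fun h => hnab ?_, Subgroup.commutator_le_frattini⟩
  exact ((commutator_eq_bot_iff G).mp h).is_comm.comm
end

section
/- Let p be a prime and let G be a non-abelian group of order p^n whose Chermak-Delgado measure takes exactly two distinct values on its subgroups. Then for every subgroup H ≤ G with Z(G) not contained in H, the subgroup H·Z(G) belongs to the Chermak-Delgado lattice of G, i.e., m_G(H·Z(G)) = m*(G) = p^{n+1}. -/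
theorem cdMeasure_lt_cdMeasure_sup_center {G : Type*} [Group G] [Finite G] {H : Subgroup G}
    (hH : ¬ Subgroup.center G ≤ H) : cdMeasure H < cdMeasure (H ⊔ Subgroup.center G) := by
  have hcent : Subgroup.centralizer (H : Set G) ≤
      Subgroup.centralizer ((H ⊔ Subgroup.center G : Subgroup G) : Set G) := by
    rw [Subgroup.le_centralizer_iff]
    exact sup_le (Subgroup.le_centralizer_iff.mp le_rfl) (Subgroup.center_le_centralizer _)
  have hcard : Nat.card H < Nat.card (H ⊔ Subgroup.center G : Subgroup G) := by
    refine lt_of_le_of_ne (Subgroup.card_le_of_le le_sup_left) fun h => hH ?_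
    exact left_eq_sup.mp (Subgroup.eq_of_le_of_card_ge le_sup_left h.ge)
  exact Nat.mul_lt_mul_of_lt_of_le hcard (Subgroup.card_le_of_le hcent) Nat.card_pos

theorem join_center_mem_CD_of_hasTwoCDValues (G : Type*) [Group G] [Finite G]
    (p n : ℕ) (hp : p.Prime) (hcard : Nat.card G = p ^ n)
    (hnab : ¬ ∀ a b : G, a * b = b * a)
    (hG : hasTwoCDValues G)
    (H : Subgroup G) (hH : ¬ Subgroup.center G ≤ H) :
    cdMeasure (H ⊔ Subgroup.center G) = p ^ (n + 1) ∧
      cdMeasure (H ⊔ Subgroup.center G) =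
        sSup (Set.range fun K : Subgroup G => cdMeasure K) := by
  have : Fact p.Prime := ⟨hp⟩
  have hdvd : p ∣ Nat.card (Subgroup.center G) := by
    obtain ⟨k, -, hk⟩ := (Nat.dvd_prime_pow hp).mp
      (hcard ▸ Subgroup.card_subgroup_dvd_card (Subgroup.center G))
    rw [hk]
    refine dvd_pow_self p fun hk0 => hH ?_
    have hbot := Subgroup.eq_bot_of_card_eq (Subgroup.center G) (by rw [hk, hk0, pow_zero])
    exact hbot ▸ bot_le
  obtain ⟨x, hx⟩ := exists_prime_orderOf_dvd_card' p hdvd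
  have hbot : cdMeasure (⊥ : Subgroup G) = p ^ n := by
    rw [cdMeasure_of_le_center bot_le, Subgroup.card_bot, one_mul, hcard]
  have hzpow : cdMeasure (Subgroup.zpowers (x : G)) = p ^ (n + 1) := by
    rw [cdMeasure_of_le_center (Subgroup.zpowers_le.mpr x.2), Nat.card_zpowers,
      Subgroup.orderOf_coe, hx, hcard, pow_succ']
  have hlt : p ^ n < p ^ (n + 1) := Nat.pow_lt_pow_right hp.one_lt n.lt_succ_self
  have hvalues : ∀ K : Subgroup G, cdMeasure K = p ^ n ∨ cdMeasure K = p ^ (n + 1) := by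
    have hsub : {p ^ n, p ^ (n + 1)} ⊆ Set.range fun K : Subgroup G => cdMeasure K := by
      rintro _ (rfl | rfl)
      exacts [⟨_, hbot⟩, ⟨_, hzpow⟩]
    have heq := Set.eq_of_subset_of_ncard_le hsub
      (by rw [Set.ncard_pair hlt.ne]; exact hG.le) (Set.finite_range _)
    intro K
    have hK : cdMeasure K ∈ Set.range fun K : Subgroup G => cdMeasure K := ⟨K, rfl⟩
    rwa [← heq] at hK
  have hmax : cdMeasure (H ⊔ Subgroup.center G) = p ^ (n + 1) := by
    have := cdMeasure_lt_cdMeasure_sup_center hH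
    have := hvalues H
    have := hvalues (H ⊔ Subgroup.center G)
    omega
  refine ⟨hmax, Eq.symm (IsGreatest.csSup_eq ⟨Set.mem_range_self _, ?_⟩)⟩
  rintro _ ⟨K, rfl⟩
  have := hvalues K
  dsimp only
  omega
end

section
/- There is no finite non-abelian p-group G such that its Chermak-Delgado measure takes exactly two distinct values on its subgroups and at the same time CD(G) = {Z(G), G}. Equivalently: if G is a finite non-abelian p-group whose Chermak-Delgado measure takes exactly two values, then there exists a subgroup H of G with m_G(H) = m*(G) and H ≠ Z(G) and H ≠ G. -/
/-- If `x` is central modulo the center of `G`, then the conjugacy class of `x` has at most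
`|Z(G)|` elements: `|G| ≤ |Z(G)| * |C_G(x)|`. -/
theorem card_le_card_center_mul_card_centralizer {G : Type*} [Group G] [Finite G] {x : G}
    (hx : ∀ g : G, g * x * g⁻¹ * x⁻¹ ∈ Subgroup.center G) :
    Nat.card G ≤
      Nat.card (Subgroup.center G) * Nat.card (Subgroup.centralizer ({x} : Set G)) := by
  let f : G →* Subgroup.center G := MonoidHom.mk' (fun g => ⟨g * x * g⁻¹ * x⁻¹, hx g⟩) (by
    intro a b
    ext
    have hb := Subgroup.mem_center_iff.mp (hx b) a
    change a * b * x * (a * b)⁻¹ * x⁻¹ = (a * x * a⁻¹ * x⁻¹) * (b * x * b⁻¹ * x⁻¹)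
    calc a * b * x * (a * b)⁻¹ * x⁻¹
        = (a * (b * x * b⁻¹ * x⁻¹)) * (x * a⁻¹ * x⁻¹) := by group
      _ = (b * x * b⁻¹ * x⁻¹) * (a * x * a⁻¹ * x⁻¹) := by rw [hb]; group
      _ = _ := (Subgroup.mem_center_iff.mp (hx b) _).symm)
  have hker : f.ker ≤ Subgroup.centralizer ({x} : Set G) := by
    intro g hg
    have h1 : g * x * g⁻¹ * x⁻¹ = 1 := congrArg Subtype.val (MonoidHom.mem_ker.mp hg)
    rw [Subgroup.mem_centralizer_singleton_iff]
    rw [mul_inv_eq_one, mul_inv_eq_iff_eq_mul] at h1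
    exact h1
  calc Nat.card G = f.ker.index * Nat.card f.ker := f.ker.index_mul_card.symm
    _ ≤ _ := by
      rw [Subgroup.index_ker]
      exact Nat.mul_le_mul (Subgroup.card_le_card_group _) (Subgroup.card_le_of_le hker)

/-- A non-abelian finite `p`-group has a non-central element that is central modulo the center. -/
theorem IsPGroup.exists_notMem_center_forall_commutator_mem_center {G : Type*} [Group G]
    [Finite G] {p : ℕ} (hp : p.Prime) (hpG : IsPGroup p G)
    (hnab : ¬ ∀ a b : G, a * b = b * a) :
    ∃ x : G, x ∉ Subgroup.center G ∧ ∀ g : G, g * x * g⁻¹ * x⁻¹ ∈ Subgroup.center G := by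
  have : Fact p.Prime := ⟨hp⟩
  have hQ : IsPGroup p (G ⧸ Subgroup.center G) := hpG.to_quotient _
  have hnt : Nontrivial (G ⧸ Subgroup.center G) := by
    rw [QuotientGroup.nontrivial_iff]
    intro h
    refine hnab fun a b => Subgroup.mem_center_iff.mp (?_ : b ∈ Subgroup.center G) a
    rw [h]
    trivial
  have := hQ.center_nontrivial
  obtain ⟨⟨y, hy⟩, hy1⟩ := exists_ne (1 : Subgroup.center (G ⧸ Subgroup.center G))
  obtain ⟨x, rfl⟩ := QuotientGroup.mk_surjective y
  refine ⟨x, fun hx => hy1 (Subtype.ext ((QuotientGroup.eq_one_iff x).mpr hx)), fun g => ?_⟩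
  rw [← QuotientGroup.eq_one_iff]
  have := Subgroup.mem_center_iff.mp hy g
  simp only [QuotientGroup.mk_mul, QuotientGroup.mk_inv]
  rw [this]
  group

/-- `C_G(⟨Z(G), x⟩) = C_G(x)`. -/
theorem centralizer_center_sup_zpowers {G : Type*} [Group G] (x : G) :
    Subgroup.centralizer ((Subgroup.center G ⊔ Subgroup.zpowers x : Subgroup G) : Set G) =
      Subgroup.centralizer ({x} : Set G) := by
  refine le_antisymm (Subgroup.centralizer_le ?_) ?_
  · rintro _ rfl
    exact Subgroup.mem_sup_right (Subgroup.mem_zpowers _)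
  · rw [Subgroup.le_centralizer_iff]
    refine sup_le (Subgroup.center_le_centralizer _) ?_
    rw [Subgroup.zpowers_le, Subgroup.mem_centralizer_iff]
    exact fun g hg => Subgroup.mem_centralizer_singleton_iff.mp hg

theorem exists_CD_member_ne_center_ne_top (G : Type*) [Group G] [Finite G]
    (p : ℕ) (hp : p.Prime) (hpG : IsPGroup p G)
    (hnab : ¬ ∀ a b : G, a * b = b * a)
    (hG : hasTwoCDValues G) :
    ∃ H : Subgroup G,
      cdMeasure H = sSup (Set.range fun K : Subgroup G => cdMeasure K) ∧
      H ≠ Subgroup.center G ∧ H ≠ ⊤ := by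
  have : Fact p.Prime := ⟨hp⟩
  obtain ⟨x, hx, hcomm⟩ := hpG.exists_notMem_center_forall_commutator_mem_center hp hnab
  have hGnt : Nontrivial G := ⟨x, 1, fun h => hx (h ▸ one_mem _)⟩
  have hbot : cdMeasure (⊥ : Subgroup G) = Nat.card G := by simp [cdMeasure]
  have htop : cdMeasure (⊤ : Subgroup G) = Nat.card G * Nat.card (Subgroup.center G) := by
    simp [cdMeasure, Subgroup.centralizer_univ]
  have hlt : cdMeasure (⊥ : Subgroup G) < cdMeasure (⊤ : Subgroup G) := by
    have := hpG.center_nontrivial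
    rw [hbot, htop]
    exact lt_mul_of_one_lt_right Nat.card_pos Finite.one_lt_card
  have hrange : Set.range (fun K : Subgroup G => cdMeasure K) =
      {cdMeasure (⊥ : Subgroup G), cdMeasure (⊤ : Subgroup G)} := by
    refine (Set.eq_of_subset_of_ncard_le ?_ ?_ (Set.toFinite _)).symm
    · rintro _ (rfl | rfl)
      exacts [⟨⊥, rfl⟩, ⟨⊤, rfl⟩]
    · rw [Set.ncard_pair hlt.ne]
      exact hG.le
  have hxH : x ∈ Subgroup.center G ⊔ Subgroup.zpowers x :=
    Subgroup.mem_sup_right (Subgroup.mem_zpowers x)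
  have hcen := centralizer_center_sup_zpowers x
  have hne : Subgroup.center G ⊔ Subgroup.zpowers x ≠ Subgroup.center G := fun h => hx (h ▸ hxH)
  refine ⟨Subgroup.center G ⊔ Subgroup.zpowers x, ?_, hne, fun h => hx ?_⟩
  · have hbig : cdMeasure (⊥ : Subgroup G) <
        cdMeasure (Subgroup.center G ⊔ Subgroup.zpowers x) := by
      have hcard : Nat.card (Subgroup.center G) <
          Nat.card (Subgroup.center G ⊔ Subgroup.zpowers x : Subgroup G) :=
        Set.ncard_lt_ncard (SetLike.coe_ssubset_coe.mpr (lt_of_le_of_ne le_sup_left hne.symm))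
      rw [hbot, cdMeasure, hcen]
      exact (card_le_card_center_mul_card_centralizer hcomm).trans_lt
        (Nat.mul_lt_mul_of_pos_right hcard Nat.card_pos)
    have hmem : cdMeasure (Subgroup.center G ⊔ Subgroup.zpowers x) ∈
        Set.range (fun K : Subgroup G => cdMeasure K) := ⟨_, rfl⟩
    rw [hrange] at hmem
    rw [hrange, csSup_pair, max_eq_right hlt.le]
    exact hmem.resolve_left hbig.ne'
  · rw [h, Subgroup.coe_top, Subgroup.centralizer_univ] at hcen
    rw [hcen, Subgroup.mem_centralizer_singleton_iff]
end

section
/- Every extraspecial p-group has the property that its Chermak-Delgado measure takes exactly two distinct values on its subgroups. -/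
/-- A finite `p`-group is extraspecial if `Z(G) = G' = Φ(G)` has order `p`. -/
def IsExtraspecial (p : ℕ) (G : Type*) [Group G] : Prop :=
  Subgroup.center G = commutator G ∧ Subgroup.center G = frattini G ∧
    Nat.card (Subgroup.center G) = p

open scoped commutatorElement IsMulCommutative

/-- The commutator pairing `G × G → Z(G)` of a group of nilpotency class at most two. -/
def centralCommutator {G : Type*} [Group G] (hG : commutator G ≤ Subgroup.center G) (a b : G) :
    Subgroup.center G :=
  ⟨⁅a, b⁆, hG (Subgroup.commutator_mem_commutator (Subgroup.mem_top a) (Subgroup.mem_top b))⟩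

section CentralCommutator

variable {G : Type*} [Group G] (hG : commutator G ≤ Subgroup.center G)

theorem centralCommutator_eq_one_iff (a b : G) :
    centralCommutator hG a b = 1 ↔ a * b = b * a := by
  rw [centralCommutator, Subtype.ext_iff]
  exact commutatorElement_eq_one_iff_mul_comm

theorem centralCommutator_mul_right (a b c : G) :
    centralCommutator hG a (b * c) = centralCommutator hG a b * centralCommutator hG a c := by
  have hc := Subgroup.mem_center_iff.mp (centralCommutator hG a c).2 b
  apply Subtype.ext
  simp only [centralCommutator, Subgroup.coe_mul] at hc ⊢
  calc ⁅a, b * c⁆ = ⁅a, b⁆ * (b * ⁅a, c⁆) * b⁻¹ := by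
        simp only [commutatorElement_def]; group
    _ = ⁅a, b⁆ * ⁅a, c⁆ := by rw [hc]; group

theorem centralCommutator_inv (a b : G) :
    (centralCommutator hG a b)⁻¹ = centralCommutator hG b a :=
  Subtype.ext (commutatorElement_inv a b)

theorem centralCommutator_mul_left (a b c : G) :
    centralCommutator hG (a * b) c = centralCommutator hG a c * centralCommutator hG b c := by
  rw [← centralCommutator_inv hG c, centralCommutator_mul_right, mul_inv, centralCommutator_inv,
    centralCommutator_inv]

end CentralCommutator

/-- In a finite group of class at most two whose center has a faithful linear character,
the Chermak–Delgado measure of `H` is `|G| * |H ∩ Z(G)|`. -/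
theorem cdMeasure_eq_card_mul_card_inf_center {G : Type*} [Group G] [Finite G]
    (hG : commutator G ≤ Subgroup.center G) (χ : Subgroup.center G →* ℂ)
    (hχ : Function.Injective χ) (H : Subgroup G) :
    cdMeasure H = Nat.card G * Nat.card (H ⊓ Subgroup.center G : Subgroup G) := by
  classical
  have := Fintype.ofFinite G
  let left (h : G) : G →* ℂ := χ.comp
    (MonoidHom.mk' (fun g => centralCommutator hG h g) (centralCommutator_mul_right hG h))
  let right (g : G) : H →* ℂ := χ.comp
    (MonoidHom.mk' (fun h : H => centralCommutator hG h g)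
      (fun a b => centralCommutator_mul_left hG a b g))
  have hχ1 (a b : G) : χ (centralCommutator hG a b) = 1 ↔ a * b = b * a := by
    rw [map_eq_one_iff χ hχ, centralCommutator_eq_one_iff]
  have hleft (h : G) : left h = 1 ↔ h ∈ Subgroup.center G := by
    rw [Subgroup.mem_center_iff, MonoidHom.ext_iff]
    exact forall_congr' fun g => (hχ1 h g).trans eq_comm
  have hright (g : G) : right g = 1 ↔ g ∈ Subgroup.centralizer (H : Set G) := by
    rw [Subgroup.mem_centralizer_iff, MonoidHom.ext_iff, Subtype.forall]
    exact forall₂_congr fun h _ => hχ1 h g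
  have hsum : ∑ h : H, ∑ g, left h g = ∑ g, ∑ h : H, right g h := Finset.sum_comm
  have hH : Nat.card (H ⊓ Subgroup.center G : Subgroup G) =
      Fintype.card {h : H // (h : G) ∈ Subgroup.center G} := by
    rw [← Nat.card_eq_fintype_card]
    exact Nat.card_congr (Equiv.subtypeSubtypeEquivSubtypeInter (· ∈ H) _).symm
  simp only [sum_hom_units, hleft, hright, Nat.cast_ite, Nat.cast_zero, ← Finset.sum_filter,
    Finset.sum_const, nsmul_eq_mul, ← Fintype.card_subtype] at hsum
  rw [cdMeasure, hH, Nat.card_eq_fintype_card, Nat.card_eq_fintype_card,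
    Nat.card_eq_fintype_card, mul_comm, mul_comm (Fintype.card G)]
  exact_mod_cast hsum.symm

/-- A finite group of prime order has a faithful linear character. -/
theorem exists_injective_monoidHom_complex_of_prime_card {Z : Type*} [CommGroup Z]
    (hZ : (Nat.card Z).Prime) : ∃ χ : Z →* ℂ, Function.Injective χ := by
  have := Nat.finite_of_card_ne_zero hZ.ne_zero
  have : Nontrivial Z := Finite.one_lt_card_iff_nontrivial.mp hZ.one_lt
  have : Fact (Nat.card Z).Prime := ⟨hZ⟩
  have : NeZero (Monoid.exponent Z) := ⟨Monoid.exponent_ne_zero_of_finite⟩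
  obtain ⟨a, ha⟩ := exists_ne (1 : Z)
  obtain ⟨φ, hφ⟩ := CommGroup.exists_apply_ne_one_of_hasEnoughRootsOfUnity Z ℂ ha
  refine ⟨(Units.coeHom ℂ).comp φ, Units.val_injective.comp ?_⟩
  rw [← MonoidHom.ker_eq_bot_iff]
  refine φ.ker.eq_bot_or_eq_top_of_prime_card.resolve_right fun h => hφ ?_
  exact φ.mem_ker.mp (h ▸ Subgroup.mem_top a)

theorem extraspecial_hasTwoCDValues (p : ℕ) (hp : p.Prime)
    (G : Type*) [Group G] [Finite G] (hpG : IsPGroup p G)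
    (hES : IsExtraspecial p G) :
    hasTwoCDValues G := by
  obtain ⟨hcomm, -, hcard⟩ := hES
  obtain ⟨χ, hχ⟩ := exists_injective_monoidHom_complex_of_prime_card (hcard ▸ hp)
  have hm := cdMeasure_eq_card_mul_card_inf_center hcomm.ge χ hχ
  have hrange : (Set.range fun H : Subgroup G => cdMeasure H) =
      {Nat.card G, Nat.card G * p} := by
    ext n
    simp only [Set.mem_range, Set.mem_insert_iff, Set.mem_singleton_iff, hm]
    constructor
    · rintro ⟨H, rfl⟩
      have hdvd := Subgroup.card_dvd_of_le (inf_le_right : H ⊓ Subgroup.center G ≤ _)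
      rw [hcard] at hdvd
      rcases (Nat.dvd_prime hp).mp hdvd with h | h <;> rw [h] <;> simp
    · rintro (rfl | rfl)
      · exact ⟨⊥, by simp⟩
      · exact ⟨⊤, by simp [hcard]⟩
  rw [hasTwoCDValues, hrange, Set.ncard_pair]
  exact (lt_mul_of_one_lt_right Nat.card_pos hp.one_lt).ne
end

section
/- Let p be a prime and let G be a non-abelian group of order p^n. If G contains an abelian subgroup of order at least p^⌊(n+3)/2⌋, then the Chermak-Delgado measure of G takes at least three distinct values on the subgroups of G (i.e., G does not belong to the class C). -/
/-- The Chermak–Delgado measure of an abelian subgroup is at least the square of its order. -/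
theorem card_mul_card_le_cdMeasure {G : Type*} [Group G] [Finite G] {A : Subgroup G}
    (hA : ∀ a b : A, a * b = b * a) : Nat.card A * Nat.card A ≤ cdMeasure A := by
  have h : A ≤ Subgroup.centralizer (A : Set G) := fun a ha =>
    Subgroup.mem_centralizer_iff.mpr fun b hb =>
      congrArg Subtype.val (hA ⟨b, hb⟩ ⟨a, ha⟩)
  exact Nat.mul_le_mul_left _ (Subgroup.card_le_of_le h)

/-- A nontrivial finite `p`-group has a central subgroup of order `p`. -/
theorem IsPGroup.exists_le_center_card_eq {G : Type*} [Group G] [Finite G] [Nontrivial G]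
    {p : ℕ} [Fact p.Prime] (hG : IsPGroup p G) :
    ∃ H : Subgroup G, H ≤ Subgroup.center G ∧ Nat.card H = p := by
  have := hG.center_nontrivial
  obtain ⟨k, hk, hcard⟩ := (hG.to_subgroup (Subgroup.center G)).nontrivial_iff_card.mp this
  obtain ⟨z, hz⟩ := exists_prime_orderOf_dvd_card' (G := Subgroup.center G) p
    (hcard ▸ dvd_pow_self p hk.ne')
  refine ⟨Subgroup.zpowers (z : G), ?_, ?_⟩
  · exact (Subgroup.zpowers_le).mpr z.2
  · rw [Nat.card_zpowers, Subgroup.orderOf_coe, hz]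

theorem not_hasTwoCDValues_of_large_abelian_subgroup (G : Type*) [Group G] [Finite G]
    (p n : ℕ) (hp : p.Prime) (hcard : Nat.card G = p ^ n)
    (hnab : ¬ ∀ a b : G, a * b = b * a)
    (A : Subgroup G) (hA : ∀ a b : A, a * b = b * a)
    (hAcard : p ^ ((n + 3) / 2) ≤ Nat.card A) :
    3 ≤ (Set.range fun H : Subgroup G => cdMeasure H).ncard := by
  have : Fact p.Prime := ⟨hp⟩
  have : Nontrivial G := by
    by_contra h
    rw [not_nontrivial_iff_subsingleton] at h
    exact hnab fun a b => Subsingleton.elim _ _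
  obtain ⟨H, hHZ, hH⟩ := (IsPGroup.of_card hcard).exists_le_center_card_eq
  have h₀ : cdMeasure (⊥ : Subgroup G) = p ^ n := by
    rw [cdMeasure_of_le_center bot_le, Subgroup.card_bot, one_mul, hcard]
  have h₁ : cdMeasure H = p ^ (n + 1) := by
    rw [cdMeasure_of_le_center hHZ, hH, hcard, pow_succ']
  have h₂ : p ^ (n + 2) ≤ cdMeasure A := calc
    p ^ (n + 2) ≤ p ^ ((n + 3) / 2 + (n + 3) / 2) := Nat.pow_le_pow_right hp.pos (by omega)
    _ = p ^ ((n + 3) / 2) * p ^ ((n + 3) / 2) := pow_add _ _ _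
    _ ≤ Nat.card A * Nat.card A := Nat.mul_le_mul hAcard hAcard
    _ ≤ cdMeasure A := card_mul_card_le_cdMeasure hA
  have h₀₁ : p ^ n < p ^ (n + 1) := Nat.pow_lt_pow_right hp.one_lt (by omega)
  have h₁₂ : p ^ (n + 1) < p ^ (n + 2) := Nat.pow_lt_pow_right hp.one_lt (by omega)
  refine (Set.two_lt_ncard (Set.finite_range _)).mpr
    ⟨_, ⟨⊥, rfl⟩, _, ⟨H, rfl⟩, _, ⟨A, rfl⟩, ?_, ?_, ?_⟩ <;> dsimp only <;> omega
end

section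
/- Let p be a prime and let G be a finite p-group of maximal class (i.e., |G| = p^n and the nilpotency class of G is n − 1) whose Chermak-Delgado measure takes exactly two distinct values on its subgroups. Then G is non-abelian of order p^3. -/
open scoped commutatorElement

namespace Subgroup

section ModCentralizer

variable {G : Type*} [Group G]

/-- The elements of `G` that centralize `S` modulo the normal subgroup `N`. -/
def modCentralizer (N : Subgroup G) [N.Normal] (S : Set G) : Subgroup G :=
  (centralizer (QuotientGroup.mk' N '' S)).comap (QuotientGroup.mk' N)

theorem mem_modCentralizer {N : Subgroup G} [N.Normal] {S : Set G} {x : G} :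
    x ∈ modCentralizer N S ↔ ∀ s ∈ S, ⁅x, s⁆ ∈ N := by
  simp only [modCentralizer, mem_comap, mem_centralizer_iff, Set.forall_mem_image]
  refine forall₂_congr fun s _ => ?_
  rw [← QuotientGroup.eq_one_iff, ← QuotientGroup.mk'_apply, map_commutatorElement,
    commutatorElement_eq_one_iff_mul_comm, eq_comm]

theorem commutatorElement_mem_comm {N : Subgroup G} {x y : G} :
    ⁅x, y⁆ ∈ N ↔ ⁅y, x⁆ ∈ N := by
  rw [← commutatorElement_inv, inv_mem_iff]

theorem mem_modCentralizer_singleton {N : Subgroup G} [N.Normal] {x y : G} :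
    y ∈ modCentralizer N {x} ↔ ⁅x, y⁆ ∈ N := by
  rw [commutatorElement_mem_comm]; simp [mem_modCentralizer]

theorem centralizer_le_modCentralizer (N : Subgroup G) [N.Normal] (S : Set G) :
    centralizer S ≤ modCentralizer N S := fun x hx => mem_modCentralizer.mpr fun s hs => by
  rw [commutatorElement_eq_one_iff_mul_comm.mpr (mem_centralizer_iff.mp hx s hs).symm]
  exact one_mem N

/-- The three subgroups lemma modulo a normal subgroup. -/
theorem commutator_commutator_le_of_rotate {H₁ H₂ H₃ N : Subgroup G} [N.Normal]
    (h1 : ⁅⁅H₂, H₃⁆, H₁⁆ ≤ N) (h2 : ⁅⁅H₃, H₁⁆, H₂⁆ ≤ N) : ⁅⁅H₁, H₂⁆, H₃⁆ ≤ N := by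
  have key : ∀ K : Subgroup G, K ≤ N ↔ K.map (QuotientGroup.mk' N) = ⊥ := fun K => by
    rw [map_eq_bot_iff, QuotientGroup.ker_mk']
  rw [key, map_commutator, map_commutator] at h1 h2 ⊢
  exact commutator_commutator_eq_bot_of_rotate h1 h2

theorem upperCentralSeries_succ_le_modCentralizer (i : ℕ) (S : Set G) :
    upperCentralSeries G (i + 1) ≤ modCentralizer (upperCentralSeries G i) S :=
  fun _ hx => mem_modCentralizer.mpr fun s _ => mem_upperCentralSeries_succ_iff.mp hx s

theorem commutator_le_modCentralizer_upperCentralSeries (i : ℕ) :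
    _root_.commutator G ≤
      modCentralizer (upperCentralSeries G i) (upperCentralSeries G (i + 2)) := by
  have h : ⁅⁅upperCentralSeries G (i + 2), ⊤⁆, (⊤ : Subgroup G)⁆ ≤ upperCentralSeries G i :=
    (commutator_mono (commutator_upperCentralSeries_top_le G (i + 1)) le_rfl).trans
      (commutator_upperCentralSeries_top_le G i)
  have h' : ⁅⁅(⊤ : Subgroup G), upperCentralSeries G (i + 2)⁆, (⊤ : Subgroup G)⁆ ≤
      upperCentralSeries G i := by rwa [commutator_comm ⊤]
  have := commutator_le.mp (commutator_commutator_le_of_rotate h' h)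
  exact fun x hx => mem_modCentralizer.mpr fun s hs => this x hx s hs

theorem mem_upperCentralSeries_of_top_le_modCentralizer {i : ℕ} {x : G}
    (h : ⊤ ≤ modCentralizer (upperCentralSeries G i) {x}) :
    x ∈ upperCentralSeries G (i + 1) :=
  mem_upperCentralSeries_succ_iff.mpr fun y => mem_modCentralizer_singleton.mp (h (mem_top y))

end ModCentralizer

section PGroup

variable {p : ℕ} [Fact p.Prime] {G : Type*} [Group G] [Finite G]

theorem _root_.IsPGroup.prime_mul_card_le_of_lt (hG : IsPGroup p G) {A B : Subgroup G} (h : A < B) :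
    p * Nat.card A ≤ Nat.card B := by
  obtain ⟨a, ha⟩ := IsPGroup.iff_card.mp (hG.to_subgroup A)
  obtain ⟨b, hb⟩ := IsPGroup.iff_card.mp (hG.to_subgroup B)
  have hlt : Nat.card A < Nat.card B := by
    by_contra! hle
    exact h.ne (eq_of_le_of_card_ge h.le hle)
  rw [ha, hb] at hlt ⊢
  rw [← pow_succ']
  exact Nat.pow_le_pow_right (Fact.out : p.Prime).pos
    ((Nat.pow_lt_pow_iff_right (Fact.out : p.Prime).one_lt).mp hlt)

/-- A subgroup containing `A` and an element outside `A` contains `B`, if `|B| = p |A|`. -/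
theorem _root_.IsPGroup.le_of_mem_of_notMem (hG : IsPGroup p G) {A B D : Subgroup G} (hAB : A ≤ B)
    (hB : Nat.card B ≤ p * Nat.card A) (hAD : A ≤ D) {u : G} (huB : u ∈ B) (huD : u ∈ D)
    (huA : u ∉ A) : B ≤ D := by
  have hlt : A < D ⊓ B := lt_of_le_of_ne (le_inf hAD hAB) fun h => huA (h ▸ ⟨huD, huB⟩)
  have := eq_of_le_of_card_ge (inf_le_right : D ⊓ B ≤ B)
    (hB.trans (hG.prime_mul_card_le_of_lt hlt))
  exact this ▸ inf_le_left

theorem card_inf_le_mul_card_inf {A B : Subgroup G} {c : ℕ} (hAB : A ≤ B)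
    (hB : Nat.card B ≤ c * Nat.card A) (D : Subgroup G) :
    Nat.card ↥(D ⊓ B) ≤ c * Nat.card ↥(D ⊓ A) := by
  have h1 : Nat.card A * A.relIndex B = Nat.card B := by
    rw [← relIndex_bot_left, relIndex_mul_relIndex _ _ _ bot_le hAB, relIndex_bot_left]
  have h2 : A.relIndex B ≤ c := by
    refine Nat.le_of_mul_le_mul_left ?_ (Nat.card_pos (α := A))
    rw [h1, mul_comm]; exact hB
  have h3 : Nat.card ↥(D ⊓ A) * (D ⊓ A).relIndex (D ⊓ B) = Nat.card ↥(D ⊓ B) := by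
    rw [← relIndex_bot_left, relIndex_mul_relIndex _ _ _ bot_le (inf_le_inf_left D hAB),
      relIndex_bot_left]
  have h4 : (D ⊓ A).relIndex (D ⊓ B) ≤ A.relIndex B := by
    have : (D ⊓ A).relIndex (D ⊓ B) = A.relIndex (D ⊓ B) := by
      rw [← inf_relIndex_right A, ← inf_relIndex_right (D ⊓ A)]
      congr 1
      ext x; simp only [mem_inf]; tauto
    rw [this]
    refine relIndex_le_of_le_right inf_le_right fun h0 => ?_
    rw [h0, mul_zero] at h1
    exact Nat.card_pos.ne h1
  rw [← h3, mul_comm]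
  exact Nat.mul_le_mul_right _ (h4.trans h2)

end PGroup

section MaximalClass

variable {p m : ℕ} {G : Type*} [Group G]

theorem upperCentralSeries_eq_top_of_class [Group.IsNilpotent G]
    (hcl : Group.nilpotencyClass G = m + 1) :
    upperCentralSeries G (m + 1) = ⊤ := hcl ▸ upperCentralSeries_nilpotencyClass

theorem upperCentralSeries_lt_succ (hcl : Group.nilpotencyClass G = m + 1) {i : ℕ} (hi : i ≤ m) :
    upperCentralSeries G i < upperCentralSeries G (i + 1) :=
  upperCentralSeries.StrictMonoOn G (by simp; omega) (by simp; omega) (Nat.lt_succ_self i)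

theorem lowerCentralSeries_le_upperCentralSeries [Group.IsNilpotent G]
    (hcl : Group.nilpotencyClass G = m + 1) (k : ℕ) :
    ∀ j, j + k = m + 1 → (⊤ : Subgroup G).lowerCentralSeries k ≤ upperCentralSeries G j := by
  induction k with
  | zero =>
    rintro j rfl
    exact le_of_le_of_eq le_top (upperCentralSeries_eq_top_of_class hcl).symm
  | succ k ih =>
    intro j hj
    exact (commutator_mono (ih (j + 1) (by omega)) le_rfl).trans
      (commutator_upperCentralSeries_top_le G j)

theorem lowerCentralSeries_succ_lt [Group.IsNilpotent G]
    (hcl : Group.nilpotencyClass G = m + 1) {k : ℕ} (hk : k ≤ m) :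
    (⊤ : Subgroup G).lowerCentralSeries (k + 1) < (⊤ : Subgroup G).lowerCentralSeries k := by
  refine lt_of_le_of_ne (lowerCentralSeries_antitone _ (Nat.le_succ k)) fun h => ?_
  have key : ∀ j, (⊤ : Subgroup G).lowerCentralSeries k ≤
      (⊤ : Subgroup G).lowerCentralSeries (k + j) := by
    intro j
    induction j with
    | zero => exact le_rfl
    | succ j ih => exact h.ge.trans (commutator_mono ih le_rfl)
  have hbot : (⊤ : Subgroup G).lowerCentralSeries (k + (m + 1 - k)) = ⊥ :=
    lowerCentralSeries_eq_bot_iff_nilpotencyClass_le.mpr (by omega)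
  have := lowerCentralSeries_eq_bot_iff_nilpotencyClass_le.mp (le_bot_iff.mp (hbot ▸ key _))
  omega

variable [Fact p.Prime] [Finite G]

theorem mul_card_upperCentralSeries_le (hpG : IsPGroup p G)
    (hcl : Group.nilpotencyClass G = m + 1) (hm : 1 ≤ m) :
    p ^ 2 * Nat.card (upperCentralSeries G m) ≤ Nat.card G := by
  obtain ⟨k, rfl⟩ : ∃ k, m = k + 1 := ⟨m - 1, by omega⟩
  have hlt := upperCentralSeries_lt_succ hcl le_rfl
  obtain ⟨x, -, hx⟩ := Set.exists_of_ssubset hlt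
  have h1 : upperCentralSeries G (k + 1) < modCentralizer (upperCentralSeries G k) {x} := by
    refine lt_of_le_of_ne (upperCentralSeries_succ_le_modCentralizer k _) fun h => hx ?_
    rw [SetLike.mem_coe, h, mem_modCentralizer_singleton]
    simp
  have h2 : modCentralizer (upperCentralSeries G k) {x} < ⊤ := by
    rw [lt_top_iff_ne_top]
    exact fun h => hx (mem_upperCentralSeries_of_top_le_modCentralizer h.ge)
  have h3 := hpG.prime_mul_card_le_of_lt h1
  have h4 := hpG.prime_mul_card_le_of_lt h2
  rw [card_top] at h4
  calc _ = p * (p * Nat.card (upperCentralSeries G (k + 1))) := by ring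
    _ ≤ _ := (Nat.mul_le_mul_left p h3).trans h4

theorem card_upperCentralSeries (hpG : IsPGroup p G) (hcard : Nat.card G = p ^ (m + 2))
    (hcl : Group.nilpotencyClass G = m + 1) (hm : 1 ≤ m) {i : ℕ} (hi : i ≤ m) :
    Nat.card (upperCentralSeries G i) = p ^ i := by
  have hp : 0 < p := (Fact.out : p.Prime).pos
  have lower : ∀ i ≤ m, p ^ i ≤ Nat.card (upperCentralSeries G i) := by
    intro i
    induction i with
    | zero => intro _; simp
    | succ i ih =>
      intro hi
      rw [pow_succ']
      exact (Nat.mul_le_mul_left p (ih (by omega))).trans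
        (hpG.prime_mul_card_le_of_lt (upperCentralSeries_lt_succ hcl (by omega)))
  have upper : ∀ j i, i + j = m → p ^ j * Nat.card (upperCentralSeries G i) ≤ p ^ m := by
    intro j
    induction j with
    | zero =>
      rintro i rfl
      have := mul_card_upperCentralSeries_le hpG hcl hm
      rw [hcard, add_comm, pow_add] at this
      simpa using Nat.le_of_mul_le_mul_left this (by positivity)
    | succ j ih =>
      intro i hij
      refine le_trans ?_ (ih (i + 1) (by omega))
      rw [pow_succ, mul_assoc]
      exact Nat.mul_le_mul_left _
        (hpG.prime_mul_card_le_of_lt (upperCentralSeries_lt_succ hcl (by omega)))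
  refine le_antisymm ?_ (lower i hi)
  have := upper (m - i) i (by omega)
  rw [show p ^ m = p ^ (m - i) * p ^ i by rw [← pow_add]; congr 1; omega] at this
  exact Nat.le_of_mul_le_mul_left this (by positivity)

theorem lowerCentralSeries_eq_upperCentralSeries [Group.IsNilpotent G]
    (hpG : IsPGroup p G)
    (hcard : Nat.card G = p ^ (m + 2)) (hcl : Group.nilpotencyClass G = m + 1) (hm : 1 ≤ m)
    {j k : ℕ} (hjk : j + k = m + 1) (hk : 1 ≤ k) :
    (⊤ : Subgroup G).lowerCentralSeries k = upperCentralSeries G j := by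
  have lower : ∀ j k, j + k = m + 1 →
      p ^ j ≤ Nat.card ((⊤ : Subgroup G).lowerCentralSeries k) := by
    intro j
    induction j with
    | zero => intro k _; exact Nat.card_pos
    | succ j ih =>
      intro k hjk
      rw [pow_succ']
      exact (Nat.mul_le_mul_left p (ih (k + 1) (by omega))).trans
        (hpG.prime_mul_card_le_of_lt (lowerCentralSeries_succ_lt hcl (by omega)))
  refine eq_of_le_of_card_ge (lowerCentralSeries_le_upperCentralSeries hcl k j hjk) ?_
  rw [card_upperCentralSeries hpG hcard hcl hm (by omega)]
  exact lower j k hjk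

theorem commutator_eq_upperCentralSeries [Group.IsNilpotent G]
    (hpG : IsPGroup p G) (hcard : Nat.card G = p ^ (m + 2))
    (hcl : Group.nilpotencyClass G = m + 1) (hm : 1 ≤ m) :
    _root_.commutator G = upperCentralSeries G m :=
  lowerCentralSeries_eq_upperCentralSeries hpG hcard hcl hm rfl le_rfl

theorem card_upperCentralSeries_succ_le (hpG : IsPGroup p G) (hcard : Nat.card G = p ^ (m + 2))
    (hcl : Group.nilpotencyClass G = m + 1) (hm : 1 ≤ m) {i : ℕ} (hi : i + 1 ≤ m) :
    Nat.card (upperCentralSeries G (i + 1)) ≤ p * Nat.card (upperCentralSeries G i) := by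
  rw [card_upperCentralSeries hpG hcard hcl hm hi,
    card_upperCentralSeries hpG hcard hcl hm (by omega), pow_succ']

open Classical in
/-- The indices of the two-step factors of the upper central series, below the term of index `m`,
that are centralized by `x`. -/
noncomputable def twoStepIndices (m : ℕ) (x : G) : Finset ℕ :=
  {i ∈ Finset.range (m - 1) |
    x ∈ modCentralizer (upperCentralSeries G i) (upperCentralSeries G (i + 2))}

omit [Finite G] in
theorem mem_twoStepIndices {x : G} {i : ℕ} : i ∈ twoStepIndices m x ↔ i < m - 1 ∧
    x ∈ modCentralizer (upperCentralSeries G i) (upperCentralSeries G (i + 2)) := by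
  simp [twoStepIndices]

theorem centralizer_inf_le_of_notMem (hpG : IsPGroup p G) (hcard : Nat.card G = p ^ (m + 2))
    (hcl : Group.nilpotencyClass G = m + 1) {x : G} {i : ℕ} (hi : i + 2 ≤ m)
    (hx : x ∉ modCentralizer (upperCentralSeries G i) (upperCentralSeries G (i + 2))) :
    centralizer {x} ⊓ upperCentralSeries G (i + 2) ≤ upperCentralSeries G (i + 1) := by
  rintro u ⟨hux, hu⟩
  by_contra hu'
  refine hx (mem_modCentralizer.mpr fun s hs => ?_)
  exact mem_modCentralizer_singleton.mp <|
    hpG.le_of_mem_of_notMem (upperCentralSeries_mono G (Nat.le_succ (i + 1)))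
      (card_upperCentralSeries_succ_le hpG hcard hcl (by omega) hi)
      (upperCentralSeries_succ_le_modCentralizer i {x}) hu
      (centralizer_le_modCentralizer _ _ hux) hu' hs

theorem card_centralizer_inf_le (hpG : IsPGroup p G) (hcard : Nat.card G = p ^ (m + 2))
    (hcl : Group.nilpotencyClass G = m + 1) (x : G) {i : ℕ} (hi : i + 1 ≤ m) :
    Nat.card ↥(centralizer {x} ⊓ upperCentralSeries G (i + 1)) ≤
      p ^ (1 + (twoStepIndices m x ∩ Finset.range i).card) := by
  have hp : 0 < p := (Fact.out : p.Prime).pos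
  induction i with
  | zero =>
    simp only [Finset.range_zero, Finset.inter_empty, Finset.card_empty]
    rw [← card_upperCentralSeries hpG hcard hcl hi hi]
    exact card_le_of_le inf_le_right
  | succ i ih =>
    have ih := ih (by omega)
    by_cases hx : x ∈ modCentralizer (upperCentralSeries G i) (upperCentralSeries G (i + 2))
    · have hS : twoStepIndices m x ∩ Finset.range (i + 1) =
          insert i (twoStepIndices m x ∩ Finset.range i) := by
        rw [Finset.range_add_one, Finset.inter_insert_of_mem]
        exact mem_twoStepIndices.mpr ⟨by omega, hx⟩
      rw [hS, Finset.card_insert_of_notMem (by simp), ← add_assoc, pow_succ']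
      exact (card_inf_le_mul_card_inf (upperCentralSeries_mono G (Nat.le_succ (i + 1)))
        (card_upperCentralSeries_succ_le hpG hcard hcl (by omega) hi) _).trans
        (Nat.mul_le_mul_left p ih)
    · refine le_trans (card_le_of_le (le_inf inf_le_left
        (centralizer_inf_le_of_notMem hpG hcard hcl hi hx))) (ih.trans ?_)
      refine Nat.pow_le_pow_right hp (Nat.add_le_add_left (Finset.card_le_card ?_) 1)
      exact Finset.inter_subset_inter_left (Finset.range_subset_range.mpr (Nat.le_succ i))

omit [Finite G] in
theorem sup_upperCentralSeries_lt_top {D : Subgroup G} (hm : 1 ≤ m) {x : G}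
    (hx : x ∉ upperCentralSeries G m) (hD : D ≤ centralizer {x}) :
    D ⊔ upperCentralSeries G m < ⊤ := by
  obtain ⟨k, rfl⟩ : ∃ k, m = k + 1 := ⟨m - 1, by omega⟩
  rw [lt_top_iff_ne_top]
  refine fun h => hx (mem_upperCentralSeries_of_top_le_modCentralizer ?_)
  rw [← h]
  exact sup_le (hD.trans (centralizer_le_modCentralizer _ _))
    (upperCentralSeries_succ_le_modCentralizer k _)

theorem card_centralizer_le (hpG : IsPGroup p G) (hcard : Nat.card G = p ^ (m + 2))
    (hcl : Group.nilpotencyClass G = m + 1) (hm : 1 ≤ m) {x : G}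
    (hx : x ∉ upperCentralSeries G m) :
    Nat.card (centralizer {x} : Subgroup G) ≤ p ^ (2 + (twoStepIndices m x).card) := by
  have hp : 0 < p := (Fact.out : p.Prime).pos
  have h1 := hpG.prime_mul_card_le_of_lt
    (sup_upperCentralSeries_lt_top hm hx (le_refl (centralizer {x})))
  rw [card_top, hcard, pow_succ'] at h1
  have h2 := Nat.le_of_mul_le_mul_left h1 hp
  rw [pow_succ', ← card_upperCentralSeries hpG hcard hcl hm le_rfl] at h2
  have h3 := card_inf_le_mul_card_inf (le_sup_right : upperCentralSeries G m ≤ _) h2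
    (centralizer {x})
  rw [inf_sup_self] at h3
  obtain ⟨k, rfl⟩ : ∃ k, m = k + 1 := ⟨m - 1, by omega⟩
  have h4 := card_centralizer_inf_le hpG hcard hcl x le_rfl
  refine h3.trans ((Nat.mul_le_mul_left p h4).trans ?_)
  rw [← pow_succ']
  refine Nat.pow_le_pow_right hp ?_
  have := Finset.card_le_card (Finset.inter_subset_left :
    twoStepIndices (k + 1) x ∩ Finset.range k ⊆ _)
  omega

theorem cdMeasure_zpowers_le (hpG : IsPGroup p G) (hcard : Nat.card G = p ^ (m + 2))
    (hcl : Group.nilpotencyClass G = m + 1) (hm : 1 ≤ m) {x : G}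
    (hx : x ∉ upperCentralSeries G m) :
    cdMeasure (zpowers x) ≤ p ^ (4 + 2 * (twoStepIndices m x).card) := by
  have h1 : Nat.card (centralizer {x} : Subgroup G) ≤ _ := card_centralizer_le hpG hcard hcl hm hx
  have h2 : Nat.card (zpowers x) ≤ Nat.card (centralizer {x} : Subgroup G) := by
    refine card_le_of_le (zpowers_le.mpr ?_)
    simp [mem_centralizer_singleton_iff]
  have h3 : centralizer (zpowers x : Set G) ≤ centralizer {x} :=
    centralizer_le (by simp)
  calc cdMeasure (zpowers x) ≤ p ^ (2 + (twoStepIndices m x).card) *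
        p ^ (2 + (twoStepIndices m x).card) :=
        Nat.mul_le_mul (h2.trans h1) ((card_le_of_le h3).trans h1)
    _ = _ := by rw [← pow_add]; congr 1; ring

omit [Finite G] in
theorem modCentralizer_two_step_ne_top (hcl : Group.nilpotencyClass G = m + 1) {i : ℕ}
    (hi : i + 2 ≤ m) :
    modCentralizer (upperCentralSeries G i) (upperCentralSeries G (i + 2)) ≠ ⊤ := by
  intro h
  obtain ⟨u, hu, hu'⟩ :=
    Set.exists_of_ssubset (upperCentralSeries_lt_succ hcl (i := i + 1) (by omega))
  refine hu' (mem_upperCentralSeries_succ_iff.mpr fun y => ?_)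
  rw [commutatorElement_mem_comm]
  exact mem_modCentralizer.mp (h ▸ mem_top y) u hu

/-- Two elements that generate a group of maximal class modulo its commutator subgroup. -/
theorem exists_pair_generating (hpG : IsPGroup p G) (hcard : Nat.card G = p ^ (m + 2))
    (hcl : Group.nilpotencyClass G = m + 1) (hm : 1 ≤ m) :
    ∃ x y : G, x ∉ upperCentralSeries G m ∧ y ∉ upperCentralSeries G m ∧
      x * y ∉ upperCentralSeries G m ∧
      ∀ D : Subgroup G, upperCentralSeries G m ≤ D → x ∈ D → y ∈ D → D = ⊤ := by
  obtain ⟨x, -, hx⟩ := Set.exists_of_ssubset (upperCentralSeries_lt_succ hcl le_rfl)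
  have hlt : zpowers x ⊔ upperCentralSeries G m < ⊤ := by
    refine sup_upperCentralSeries_lt_top hm hx (zpowers_le.mpr ?_)
    simp [mem_centralizer_singleton_iff]
  have hxD : x ∈ zpowers x ⊔ upperCentralSeries G m := mem_sup_left (mem_zpowers x)
  obtain ⟨y, -, hy⟩ := Set.exists_of_ssubset hlt
  refine ⟨x, y, hx, fun h => hy (mem_sup_right h), fun h => hy ?_, fun D hD hxD' hyD => ?_⟩
  · exact (Subgroup.mul_mem_cancel_left _ hxD).mp (mem_sup_right h)
  · have hlt' : upperCentralSeries G m < zpowers x ⊔ upperCentralSeries G m :=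
      lt_of_le_of_ne le_sup_right fun h => hx (h ▸ hxD)
    have h1 := hpG.prime_mul_card_le_of_lt hlt'
    rw [card_upperCentralSeries hpG hcard hcl hm le_rfl] at h1
    refine top_le_iff.mp (hpG.le_of_mem_of_notMem le_top ?_
      (sup_le (zpowers_le.mpr hxD') hD) (mem_top y) hyD hy)
    rw [card_top, hcard]
    calc p ^ (m + 2) = p * (p * p ^ m) := by ring
      _ ≤ _ := Nat.mul_le_mul_left p h1

/-- In a group of maximal class of order `p ^ 6`, the two top two-step centralizers agree. -/
theorem modCentralizer_two_four_le [Group.IsNilpotent G]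
    (hpG : IsPGroup p G) (hcard : Nat.card G = p ^ (4 + 2))
    (hcl : Group.nilpotencyClass G = 4 + 1) :
    modCentralizer (upperCentralSeries G 2) (upperCentralSeries G 4) ≤
      modCentralizer (upperCentralSeries G 1) (upperCentralSeries G 3) := by
  set M := modCentralizer (upperCentralSeries G 2) (upperCentralSeries G 4) with hM
  have hG' : _root_.commutator G = upperCentralSeries G 4 :=
    commutator_eq_upperCentralSeries hpG hcard hcl (by norm_num)
  have h3 : ⁅upperCentralSeries G 4, (⊤ : Subgroup G)⁆ = upperCentralSeries G 3 := by
    rw [← lowerCentralSeries_eq_upperCentralSeries hpG hcard hcl (by norm_num)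
      (show 4 + 1 = 4 + 1 from rfl) le_rfl,
      ← lowerCentralSeries_eq_upperCentralSeries hpG hcard hcl (by norm_num)
      (show 3 + 2 = 4 + 1 from rfl) (by norm_num)]
    rfl
  have h43 : upperCentralSeries G 4 ≤
      modCentralizer (upperCentralSeries G 1) (upperCentralSeries G 3) :=
    hG' ▸ commutator_le_modCentralizer_upperCentralSeries 1
  have h44 : ⁅upperCentralSeries G 4, upperCentralSeries G 4⁆ ≤ upperCentralSeries G 1 := by
    refine commutator_le.mpr fun u hu v hv => ?_
    by_cases hu3 : u ∈ upperCentralSeries G 3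
    · exact commutatorElement_mem_comm.mp (mem_modCentralizer.mp (h43 hv) u hu3)
    · refine mem_modCentralizer_singleton.mp (hpG.le_of_mem_of_notMem
        (upperCentralSeries_mono G (Nat.le_succ 3))
        (card_upperCentralSeries_succ_le hpG hcard hcl (by norm_num) le_rfl)
        (fun w hw => ?_) hu ?_ hu3 hv)
      · exact mem_modCentralizer_singleton.mpr (mem_modCentralizer.mp (h43 hu) w hw)
      · simp [mem_modCentralizer_singleton]
  have hM4 : ⁅M, upperCentralSeries G 4⁆ ≤ upperCentralSeries G 2 :=
    commutator_le.mpr fun g hg u hu => mem_modCentralizer.mp hg u hu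
  have h5 : ⁅⁅(⊤ : Subgroup G), M⁆, upperCentralSeries G 4⁆ ≤ upperCentralSeries G 1 := by
    refine (commutator_mono ?_ le_rfl).trans h44
    exact (commutator_mono le_rfl le_top).trans hG'.le
  have h6 : ⁅⁅M, upperCentralSeries G 4⁆, (⊤ : Subgroup G)⁆ ≤ upperCentralSeries G 1 :=
    (commutator_mono hM4 le_rfl).trans (commutator_upperCentralSeries_top_le G 1)
  have h7 := commutator_commutator_le_of_rotate h5 h6
  rw [h3, commutator_comm] at h7
  exact fun g hg => mem_modCentralizer.mpr fun u hu => commutator_le.mp h7 g hg u hu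

/-- In a group of maximal class of order `p ^ 4`, some subgroup has measure at least `p ^ 6`. -/
theorem exists_pow_six_le_cdMeasure (hpG : IsPGroup p G) (hcard : Nat.card G = p ^ (2 + 2))
    (hcl : Group.nilpotencyClass G = 2 + 1) : ∃ A : Subgroup G, p ^ 6 ≤ cdMeasure A := by
  have hp : 0 < p := (Fact.out : p.Prime).pos
  have h1 : Nat.card (upperCentralSeries G 1) = p ^ 1 :=
    card_upperCentralSeries hpG hcard hcl (by norm_num) (by norm_num)
  have h2 : Nat.card (upperCentralSeries G 2) = p ^ 2 :=
    card_upperCentralSeries hpG hcard hcl (by norm_num) le_rfl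
  obtain ⟨u, hu, hu'⟩ :=
    Set.exists_of_ssubset (upperCentralSeries_lt_succ hcl (i := 1) (by norm_num))
  have hmem : ∀ g : G, ⁅g, u⁆ ∈ center G := fun g => by
    rw [← upperCentralSeries_one, commutatorElement_mem_comm]
    exact mem_upperCentralSeries_succ_iff.mp hu g
  let f : G →* center G := MonoidHom.mk' (fun g => ⟨⁅g, u⁆, hmem g⟩) fun a b => by
    ext
    simp only [MulMemClass.mk_mul_mk]
    rw [commutatorElement_mul_left_eq_conj_mul, mem_center_iff.mp (hmem b) a,
      mul_inv_cancel_right, mem_center_iff.mp (hmem a)]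
  have hker : f.ker ≤ centralizer {u} := fun g hg => by
    rw [MonoidHom.mem_ker, Subtype.ext_iff] at hg
    exact mem_centralizer_singleton_iff.mpr (commutatorElement_eq_one_iff_mul_comm.mp hg)
  have hcu : p ^ 3 ≤ Nat.card (centralizer {u} : Subgroup G) := by
    refine le_trans ?_ (card_le_of_le hker)
    have h3 := f.ker.card_mul_index
    have h4 : f.ker.index ≤ p := by
      rw [index_ker]
      refine (card_le_card_group _).trans ?_
      rw [← upperCentralSeries_one, h1, pow_one]
    rw [hcard] at h3
    refine Nat.le_of_mul_le_mul_right (c := p) ?_ hp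
    calc p ^ 3 * p = Nat.card f.ker * f.ker.index := by rw [h3]; ring
      _ ≤ _ := Nat.mul_le_mul_left _ h4
  have hcover : ∀ v : G, u ∈ centralizer {v} → upperCentralSeries G 2 ≤ centralizer {v} :=
    fun v hv => hpG.le_of_mem_of_notMem (upperCentralSeries_mono G (Nat.le_succ 1))
      (card_upperCentralSeries_succ_le hpG hcard hcl (by norm_num) le_rfl)
      ((upperCentralSeries_one G).le.trans (center_le_centralizer _)) hu hv hu'
  have hcomm : ∀ v ∈ centralizer {u}, upperCentralSeries G 2 ≤ centralizer {v} :=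
    fun v hv => hcover v <| by
      rw [mem_centralizer_singleton_iff] at hv ⊢
      exact hv.symm
  obtain ⟨x, hxu, hx⟩ : ∃ x ∈ centralizer {u}, x ∉ upperCentralSeries G 2 := by
    by_contra! hle
    have := (hcu.trans (card_le_of_le hle)).trans h2.le
    exact absurd ((Nat.pow_le_pow_iff_right (Fact.out : p.Prime).one_lt).mp this) (by norm_num)
  have hcu' : upperCentralSeries G 2 ≤ centralizer {u} := hcover u <| by
    simp [mem_centralizer_singleton_iff]
  have hx2 : zpowers x ≤ centralizer (upperCentralSeries G 2) := by
    rw [le_centralizer_iff, zpowers_eq_closure, centralizer_closure]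
    exact hcomm x hxu
  have h22 : upperCentralSeries G 2 ≤ centralizer (upperCentralSeries G 2) := fun v hv =>
    mem_centralizer_iff.mpr fun w hw =>
      mem_centralizer_singleton_iff.mp (hcomm v (hcu' hv) hw)
  have hle : upperCentralSeries G 2 ⊔ zpowers x ≤
      centralizer (upperCentralSeries G 2 ⊔ zpowers x : Subgroup G) := by
    refine sup_le ?_ ?_ <;> rw [le_centralizer_iff]
    · exact sup_le h22 hx2
    · refine sup_le (le_centralizer_iff.mp hx2) (le_centralizer _)
  have hA : p ^ 3 ≤ Nat.card ↥(upperCentralSeries G 2 ⊔ zpowers x) := by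
    rw [pow_succ', ← h2]
    refine hpG.prime_mul_card_le_of_lt (lt_of_le_of_ne le_sup_left fun h => hx ?_)
    rw [h]
    exact mem_sup_right (mem_zpowers x)
  refine ⟨upperCentralSeries G 2 ⊔ zpowers x, ?_⟩
  calc p ^ 6 = p ^ 3 * p ^ 3 := by ring
    _ ≤ _ := Nat.mul_le_mul hA (hA.trans (card_le_of_le hle))

theorem not_hasTwoCDValues_of_class [Group.IsNilpotent G]
    (hpG : IsPGroup p G) (hcard : Nat.card G = p ^ (m + 2))
    (hcl : Group.nilpotencyClass G = m + 1) (hm : 2 ≤ m) : ¬ hasTwoCDValues G := by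
  intro hG
  have hp : 1 < p := (Fact.out : p.Prime).one_lt
  have hbot : cdMeasure (⊥ : Subgroup G) = p ^ (m + 2) := by
    rw [cdMeasure, centralizer_eq_top_iff_subset.mpr (by simp), card_top, hcard]
    simp
  have htop : cdMeasure (⊤ : Subgroup G) = p ^ (m + 3) := by
    rw [cdMeasure, coe_top, centralizer_univ, card_top, hcard, ← upperCentralSeries_one,
      card_upperCentralSeries hpG hcard hcl (by omega) (by omega)]
    ring
  have hcd : ∀ H : Subgroup G, cdMeasure H = p ^ (m + 2) ∨ cdMeasure H = p ^ (m + 3) := by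
    intro H
    obtain ⟨a, b, -, hab⟩ := Set.ncard_eq_two.mp hG
    have h1 := hab ▸ Set.mem_range_self (f := fun H : Subgroup G => cdMeasure H) ⊥
    have h2 := hab ▸ Set.mem_range_self (f := fun H : Subgroup G => cdMeasure H) ⊤
    have h3 := hab ▸ Set.mem_range_self (f := fun H : Subgroup G => cdMeasure H) H
    have hne : p ^ (m + 2) ≠ p ^ (m + 3) := (Nat.pow_lt_pow_right hp (Nat.lt_succ_self _)).ne
    simp only [hbot, htop, Set.mem_insert_iff, Set.mem_singleton_iff] at h1 h2 h3
    grind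
  have hS : ∀ x ∉ upperCentralSeries G m, m ≤ 2 + 2 * (twoStepIndices m x).card := by
    intro x hx
    have h1 := cdMeasure_zpowers_le hpG hcard hcl (by omega) hx
    have h2 : p ^ (m + 2) ≤ cdMeasure (zpowers x) := by
      rcases hcd (zpowers x) with h | h <;> rw [h]
      exact Nat.pow_le_pow_right (by omega) (by omega)
    have := (Nat.pow_le_pow_iff_right hp).mp (h2.trans h1)
    omega
  obtain ⟨x, y, hx, hy, hxy, hgen⟩ := exists_pair_generating hpG hcard hcl (by omega)
  have hdisj : ∀ i < m - 1,
      ¬ (x ∈ modCentralizer (upperCentralSeries G i) (upperCentralSeries G (i + 2)) ∧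
        y ∈ modCentralizer (upperCentralSeries G i) (upperCentralSeries G (i + 2))) :=
    fun i hi h => modCentralizer_two_step_ne_top hcl (by omega) <| hgen _
      (commutator_eq_upperCentralSeries hpG hcard hcl (by omega) ▸
        commutator_le_modCentralizer_upperCentralSeries i) h.1 h.2
  have d1 : Disjoint (twoStepIndices m x) (twoStepIndices m y) := by
    refine Finset.disjoint_left.mpr fun i h1 h2 => ?_
    rw [mem_twoStepIndices] at h1 h2
    exact hdisj i h1.1 ⟨h1.2, h2.2⟩
  have d2 : Disjoint (twoStepIndices m x ∪ twoStepIndices m y) (twoStepIndices m (x * y)) := by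
    refine Finset.disjoint_left.mpr fun i h1 h2 => ?_
    rw [Finset.mem_union, mem_twoStepIndices, mem_twoStepIndices] at h1
    rw [mem_twoStepIndices] at h2
    rcases h1 with h1 | h1
    · exact hdisj i h1.1 ⟨h1.2, (Subgroup.mul_mem_cancel_left _ h1.2).mp h2.2⟩
    · exact hdisj i h1.1 ⟨(Subgroup.mul_mem_cancel_right _ h1.2).mp h2.2, h1.2⟩
  have hsub : twoStepIndices m x ∪ twoStepIndices m y ∪ twoStepIndices m (x * y) ⊆
      Finset.range (m - 1) := by
    intro i
    simp only [Finset.mem_union, mem_twoStepIndices, Finset.mem_range]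
    tauto
  have hsum := Finset.card_le_card hsub
  rw [Finset.card_union_of_disjoint d2, Finset.card_union_of_disjoint d1,
    Finset.card_range] at hsum
  have hSx := hS x hx
  have hSy := hS y hy
  have hSxy := hS _ hxy
  obtain rfl | rfl : m = 2 ∨ m = 4 := by omega
  · obtain ⟨A, hA⟩ := exists_pow_six_le_cdMeasure hpG hcard hcl
    have h5 : p ^ 6 ≤ p ^ 5 := by
      refine hA.trans ?_
      rcases hcd A with h | h <;> rw [h]
      exact Nat.pow_le_pow_right (by omega) (by omega)
    exact absurd ((Nat.pow_le_pow_iff_right hp).mp h5) (by norm_num)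
  · have hunion : twoStepIndices 4 x ∪ twoStepIndices 4 y ∪ twoStepIndices 4 (x * y) =
        Finset.range 3 := by
      refine Finset.eq_of_subset_of_card_le hsub ?_
      rw [Finset.card_union_of_disjoint d2, Finset.card_union_of_disjoint d1, Finset.card_range]
      omega
    have hone : ∀ g : G, (twoStepIndices 4 g).card = 1 → 2 ∉ twoStepIndices 4 g := by
      intro g hg h2
      have h1 : 1 ∈ twoStepIndices 4 g := mem_twoStepIndices.mpr ⟨by norm_num,
        modCentralizer_two_four_le hpG hcard hcl (mem_twoStepIndices.mp h2).2⟩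
      exact absurd (Finset.card_le_one.mp hg.le 1 h1 2 h2) (by norm_num)
    have h2 : 2 ∈ twoStepIndices 4 x ∪ twoStepIndices 4 y ∪ twoStepIndices 4 (x * y) := by
      simp [hunion]
    simp only [Finset.mem_union] at h2
    rcases h2 with (h2 | h2) | h2
    · exact hone _ (by omega) h2
    · exact hone _ (by omega) h2
    · exact hone _ (by omega) h2

end MaximalClass

section Small

variable {p : ℕ} {G : Type*} [Group G]

theorem not_hasTwoCDValues_of_subsingleton [Subsingleton G] : ¬ hasTwoCDValues G := by
  intro h
  obtain ⟨a, b, hab, hr⟩ := Set.ncard_eq_two.mp h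
  have hs : (Set.range fun H : Subgroup G => cdMeasure H).Subsingleton :=
    Set.subsingleton_range _
  exact hab (hs (hr ▸ Set.mem_insert a _) (hr ▸ Set.mem_insert_of_mem a rfl))

theorem not_hasTwoCDValues_of_card_prime_sq [Fact p.Prime] [Finite G]
    (hcard : Nat.card G = p ^ 2) : ¬ hasTwoCDValues G := by
  intro h
  have hp : 1 < p := (Fact.out : p.Prime).one_lt
  have := IsPGroup.isMulCommutative_of_card_eq_prime_sq hcard
  have hcd : ∀ H : Subgroup G, cdMeasure H = Nat.card H * p ^ 2 := fun H => by
    have hH : centralizer (H : Set G) = ⊤ :=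
      (eq_top_iff' _).mpr fun x => mem_centralizer_iff.mpr fun y _ => mul_comm' y x
    rw [cdMeasure, hH, card_top, hcard]
  obtain ⟨H, hH⟩ := Sylow.exists_subgroup_card_pow_prime (G := G) p (n := 1)
    (by rw [hcard]; exact pow_dvd_pow p (by norm_num))
  obtain ⟨a, b, -, hab⟩ := Set.ncard_eq_two.mp h
  have h1 := hab ▸ Set.mem_range_self (f := fun H : Subgroup G => cdMeasure H) ⊥
  have h2 := hab ▸ Set.mem_range_self (f := fun H : Subgroup G => cdMeasure H) ⊤
  have h3 := hab ▸ Set.mem_range_self (f := fun H : Subgroup G => cdMeasure H) H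
  simp only [hcd, hH, card_top, card_bot, hcard, ← pow_add, Set.mem_insert_iff,
    Set.mem_singleton_iff, one_mul] at h1 h2 h3
  have e1 : p ^ 2 < p ^ (1 + 2) := Nat.pow_lt_pow_right hp (by norm_num)
  have e2 : p ^ (1 + 2) < p ^ (2 + 2) := Nat.pow_lt_pow_right hp (by norm_num)
  omega

end Small

end Subgroup

/-- A finite `p`-group of maximal class (order `p ^ n`, nilpotency class `n - 1`)
belonging to the class `C` is non-abelian of order `p ^ 3`. -/
theorem maximal_class_hasTwoCDValues (p n : ℕ) (hp : p.Prime)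
    (G : Type*) [Group G] [Finite G] [Group.IsNilpotent G] (hpG : IsPGroup p G)
    (hcard : Nat.card G = p ^ n)
    (hmax : Group.nilpotencyClass G = n - 1)
    (hG : hasTwoCDValues G) :
    (¬ ∀ a b : G, a * b = b * a) ∧ Nat.card G = p ^ 3 := by
  have : Fact p.Prime := ⟨hp⟩
  match n, hcard, hmax with
  | 0, hcard, _ =>
    have : Subsingleton G := (Nat.card_eq_one_iff_unique.mp (by simpa using hcard)).1
    exact absurd hG Subgroup.not_hasTwoCDValues_of_subsingleton
  | 1, _, hmax =>
    have : Subsingleton G := Group.nilpotencyClass_zero_iff_subsingleton.mp hmax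
    exact absurd hG Subgroup.not_hasTwoCDValues_of_subsingleton
  | 2, hcard, _ => exact absurd hG (Subgroup.not_hasTwoCDValues_of_card_prime_sq hcard)
  | 3, hcard, hmax =>
    refine ⟨fun h => ?_, hcard⟩
    let _ : CommGroup G := { ‹Group G› with mul_comm := h }
    have := CommGroup.nilpotencyClass_le_one (G := G)
    omega
  | m + 4, hcard, hmax =>
    exact absurd hG (Subgroup.not_hasTwoCDValues_of_class hpG (m := m + 2) hcard hmax (by omega))
end

section
/- For every prime p and every odd positive integer n, there exists a group G of order p^n whose Chermak-Delgado measure takes exactly two distinct values on its subgroups. -/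
open Module

theorem Subgroup.card_ker_inf_mul_card_map {G N : Type*} [Group G] [Group N] (f : G →* N)
    (H : Subgroup G) : Nat.card (f.ker ⊓ H : Subgroup G) * Nat.card (H.map f) = Nat.card H := by
  rw [← Subgroup.relIndex_ker, ← Subgroup.inf_relIndex_right, ← Subgroup.relIndex_bot_left,
    Subgroup.relIndex_mul_relIndex _ _ _ bot_le inf_le_right, Subgroup.relIndex_bot_left]

theorem Subgroup.card_comap_eq_card_ker_mul {G N : Type*} [Group G] [Group N] {f : G →* N}
    (hf : Function.Surjective f) (K : Subgroup N) :
    Nat.card (K.comap f) = Nat.card f.ker * Nat.card K := by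
  rw [← Subgroup.card_ker_inf_mul_card_map f, Subgroup.map_comap_eq_self_of_surjective hf,
    inf_eq_left.mpr (MonoidHom.ker_le_comap f K)]

theorem LinearMap.BilinForm.card_mul_card_orthogonal {K V : Type*} [Field K] [Finite K]
    [AddCommGroup V] [Module K V] [FiniteDimensional K V] {B : LinearMap.BilinForm K V}
    (hB : LinearMap.ker B = ⊥) (W : Submodule K V) :
    Nat.card W * Nat.card (B.orthogonal W) = Nat.card V := by
  have h := LinearMap.BilinForm.finrank_add_finrank_orthogonal' (B := B) W
  rw [hB, inf_bot_eq, finrank_bot, add_zero] at h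
  rw [natCard_eq_pow_finrank (K := K) (V := W), natCard_eq_pow_finrank (K := K) (V := V),
    natCard_eq_pow_finrank (K := K) (V := B.orthogonal W), ← pow_add, h]

/-- The central extension of the additive group `V` by `R` with cocycle the bilinear form `β`. -/
@[ext]
structure BilinExtension {R V : Type*} [CommRing R] [AddCommGroup V] [Module R V]
    (β : LinearMap.BilinForm R V) where
  /-- The component in the quotient `V`. -/
  fst : V
  /-- The component in the central subgroup `R`. -/
  snd : R

namespace BilinExtension

section CommRing

variable {R V : Type*} [CommRing R] [AddCommGroup V] [Module R V] {β : LinearMap.BilinForm R V}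

instance : Mul (BilinExtension β) := ⟨fun x y => ⟨x.fst + y.fst, x.snd + y.snd + β x.fst y.fst⟩⟩

instance : One (BilinExtension β) := ⟨⟨0, 0⟩⟩

instance : Inv (BilinExtension β) := ⟨fun x => ⟨-x.fst, -x.snd + β x.fst x.fst⟩⟩

@[simp] theorem mul_fst (x y : BilinExtension β) : (x * y).fst = x.fst + y.fst := rfl

@[simp] theorem mul_snd (x y : BilinExtension β) :
    (x * y).snd = x.snd + y.snd + β x.fst y.fst := rfl

@[simp] theorem one_fst : (1 : BilinExtension β).fst = 0 := rfl

@[simp] theorem one_snd : (1 : BilinExtension β).snd = 0 := rfl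

@[simp] theorem inv_fst (x : BilinExtension β) : x⁻¹.fst = -x.fst := rfl

@[simp] theorem inv_snd (x : BilinExtension β) : x⁻¹.snd = -x.snd + β x.fst x.fst := rfl

instance : Group (BilinExtension β) :=
  Group.ofLeftAxioms
    (fun x y z => by ext <;> simp <;> abel)
    (fun x => by ext <;> simp)
    (fun x => by ext <;> simp)

variable (β) in
/-- The underlying type of the extension is a product. -/
def equivProd : BilinExtension β ≃ V × R where
  toFun x := (x.fst, x.snd)
  invFun x := ⟨x.1, x.2⟩

instance [Finite V] [Finite R] : Finite (BilinExtension β) := Finite.of_equiv _ (equivProd β).symm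

variable (β) in
theorem card_eq : Nat.card (BilinExtension β) = Nat.card V * Nat.card R := by
  rw [Nat.card_congr (equivProd β), Nat.card_prod]

variable (β) in
/-- The projection of the extension onto its quotient `V`. -/
def proj : BilinExtension β →* Multiplicative V where
  toFun x := Multiplicative.ofAdd x.fst
  map_one' := rfl
  map_mul' _ _ := rfl

theorem proj_surjective : Function.Surjective (proj β) := fun v => ⟨⟨v.toAdd, 0⟩, rfl⟩

theorem card_ker_proj [Finite V] : Nat.card (proj β).ker = Nat.card R := by
  have h := (proj β).ker.card_mul_index
  rw [Subgroup.index_ker, MonoidHom.range_eq_top.mpr proj_surjective, Subgroup.card_top,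
    card_eq, mul_comm] at h
  exact Nat.eq_of_mul_eq_mul_left Nat.card_pos h

theorem mul_comm_iff (x y : BilinExtension β) :
    x * y = y * x ↔ (β - β.flip) x.fst y.fst = 0 := by
  simp [BilinExtension.ext_iff, add_comm, sub_eq_zero]

end CommRing

variable {p : ℕ} [Fact p.Prime] {V : Type*} [AddCommGroup V] [Module (ZMod p) V]
  {β : LinearMap.BilinForm (ZMod p) V}

/-- The image in `V` of a subgroup of the extension, as a subspace. -/
def image (H : Subgroup (BilinExtension β)) : Submodule (ZMod p) V :=
  AddSubgroup.toZModSubmodule p (Subgroup.toAddSubgroup' (H.map (proj β)))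

theorem mem_image {H : Subgroup (BilinExtension β)} {v : V} :
    v ∈ image H ↔ ∃ x ∈ H, x.fst = v := Iff.rfl

theorem centralizer_eq_comap (H : Subgroup (BilinExtension β)) :
    Subgroup.centralizer (H : Set (BilinExtension β)) = (AddSubgroup.toSubgroup
      ((β - β.flip).orthogonal (image H)).toAddSubgroup).comap (proj β) := by
  ext x
  change _ ↔ x.fst ∈ (β - β.flip).orthogonal (image H)
  simp only [Subgroup.mem_centralizer_iff, LinearMap.BilinForm.mem_orthogonal_iff, mem_image,
    SetLike.mem_coe, mul_comm_iff, forall_exists_index, and_imp]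
  exact ⟨fun h v y hy hv => hv ▸ h y hy, fun h y hy => h _ y hy rfl⟩

variable [Finite V]

theorem cdMeasure_eq (hβ : LinearMap.ker (β - β.flip) = ⊥) (H : Subgroup (BilinExtension β)) :
    cdMeasure H = Nat.card ((proj β).ker ⊓ H : Subgroup _) * Nat.card (BilinExtension β) := by
  have hW : Nat.card (H.map (proj β)) = Nat.card (image H) := rfl
  rw [cdMeasure, centralizer_eq_comap, Subgroup.card_comap_eq_card_ker_mul proj_surjective,
    card_ker_proj, ← Subgroup.card_ker_inf_mul_card_map (proj β) H, hW, card_eq,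
    ← LinearMap.BilinForm.card_mul_card_orthogonal hβ (image H)]
  change _ * _ * (_ * Nat.card ((β - β.flip).orthogonal (image H))) = _
  ring

theorem hasTwoCDValues_of_ker_eq_bot (hβ : LinearMap.ker (β - β.flip) = ⊥) :
    hasTwoCDValues (BilinExtension β) := by
  have hp : p.Prime := Fact.out
  have hker : Nat.card (proj β).ker = p := by rw [card_ker_proj, Nat.card_zmod]
  rw [hasTwoCDValues, Set.ncard_eq_two]
  refine ⟨1 * Nat.card (BilinExtension β), p * Nat.card (BilinExtension β),
    fun h => hp.one_lt.ne (Nat.eq_of_mul_eq_mul_right Nat.card_pos h), ?_⟩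
  ext m
  simp only [Set.mem_range, Set.mem_insert_iff, Set.mem_singleton_iff, cdMeasure_eq hβ]
  constructor
  · rintro ⟨H, rfl⟩
    have h := Subgroup.card_dvd_of_le (inf_le_left : (proj β).ker ⊓ H ≤ _)
    rw [hker] at h
    exact (hp.eq_one_or_self_of_dvd _ h).imp (congrArg (· * _)) (congrArg (· * _))
  · rintro (rfl | rfl)
    · exact ⟨⊥, by simp⟩
    · exact ⟨⊤, by rw [inf_top_eq, hker]⟩

end BilinExtension

/-- The bilinear form on `Rᵏ × Rᵏ` pairing `(a, b)` and `(c, d)` to the dot product of `a` and `d`. -/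
def heisenbergForm (R : Type*) [CommRing R] (k : ℕ) :
    LinearMap.BilinForm R ((Fin k → R) × (Fin k → R)) :=
  (dotProductBilin R R).compl₁₂ (LinearMap.fst R _ _) (LinearMap.snd R _ _)

theorem ker_heisenbergForm_sub_flip (R : Type*) [CommRing R] (k : ℕ) :
    LinearMap.ker (heisenbergForm R k - (heisenbergForm R k).flip) = ⊥ := by
  rw [LinearMap.ker_eq_bot']
  rintro ⟨a, b⟩ h
  have key (a' b' : Fin k → R) : a ⬝ᵥ b' - a' ⬝ᵥ b = 0 := LinearMap.congr_fun h (a', b')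
  ext i
  · simpa using key 0 (Pi.single i 1)
  · simpa using key (Pi.single i 1) 0

theorem exists_group_hasTwoCDValues_of_odd (p n : ℕ) (hp : p.Prime)
    (hn : 0 < n) (hodd : Odd n) :
    ∃ (G : Type) (_ : Group G) (_ : Finite G),
      Nat.card G = p ^ n ∧ hasTwoCDValues G := by
  have : Fact p.Prime := ⟨hp⟩
  obtain ⟨k, rfl⟩ := hodd
  refine ⟨BilinExtension (heisenbergForm (ZMod p) k), inferInstance, inferInstance, ?_,
    BilinExtension.hasTwoCDValues_of_ker_eq_bot (ker_heisenbergForm_sub_flip _ k)⟩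
  rw [BilinExtension.card_eq, Nat.card_prod, Nat.card_fun, Nat.card_zmod, Nat.card_fin]
  ring
end
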